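/- arXiv:2303.00570 — 2 statements merged into one kernel-verified Lean document; each statement's English description precedes it below -/
import Mathlib

section
/- Let d ≥ 1 be an integer, β > 0, and let V ∈ C²(ℝ^d) be positive with Z_β := ∫ V^{-β} dx < ∞. Suppose there exists γ ∈ (0, β/(d+2)) such that V^γ is convex with ∇²(V^γ)(x) invertible for every x ∈ ℝ^d and such that sup_{x∈ℝ^d} ‖V(x)^{γ−1} (∇²(V^γ))^{-1}(x)‖₂ ≤ C_V(γ) for some constant C_V(γ) > 0, where ‖·‖₂ denotes the matrix operator norm. Then for every smooth, π_β-square-integrable function φ on ℝ^d: Var_{π_β}(φ) ≤ C_V(γ)·(β/γ − 1)^{-1} ∫_{ℝ^d} |∇φ(x)|² V(x) π_β(x) dx. -/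
open MeasureTheory Real Matrix

/-- The Hessian matrix of `f : ℝ^d → ℝ` at `x`. -/
noncomputable def hessianMatrix {d : ℕ} (f : EuclideanSpace ℝ (Fin d) → ℝ)
    (x : EuclideanSpace ℝ (Fin d)) : Matrix (Fin d) (Fin d) ℝ :=
  Matrix.of fun i j =>
    iteratedFDeriv ℝ 2 f x ![EuclideanSpace.single i 1, EuclideanSpace.single j 1]


/-- One-dimensional Brunn Minkowski, midpoint form. -/
lemma pl_bm_compact {K L T : Set ℝ} (hK : IsCompact K) (hL : IsCompact L)
    (hKn : K.Nonempty) (hLn : L.Nonempty) (h : ∀ a ∈ K, ∀ b ∈ L, a + b ∈ T) :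
    volume K + volume L ≤ volume T := by
  set α := sSup K
  set β := sInf L
  have hα : α ∈ K := hK.sSup_mem hKn
  have hβ : β ∈ L := hL.sInf_mem hLn
  set K' : Set ℝ := (fun x => x + (-β)) ⁻¹' K
  set L' : Set ℝ := (fun x => x + (-α)) ⁻¹' L
  have h1 : volume K' = volume K := measure_preimage_add_right _ _ _
  have h2 : volume L' = volume L := measure_preimage_add_right _ _ _
  have hL'm : MeasurableSet L' := (measurable_id.add_const _) hL.measurableSet
  have h3 := measure_union_add_inter (μ := (volume : Measure ℝ)) K' hL'm
  have h4 : K' ∩ L' ⊆ {α + β} := by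
    rintro x ⟨hx1, hx2⟩
    have e1 : x + -β ≤ α := le_csSup hK.bddAbove hx1
    have e2 : β ≤ x + -α := csInf_le hL.bddBelow hx2
    simp only [Set.mem_singleton_iff]
    linarith
  have h5 : volume (K' ∩ L') = 0 := measure_mono_null h4 (by simp)
  have h6 : K' ∪ L' ⊆ T := by
    rintro x (hx | hx)
    · have := h _ hx _ hβ
      simpa using this
    · have := h _ hα _ hx
      simpa [add_comm] using this
  rw [h5, add_zero, h1, h2] at h3
  rw [← h3]
  exact measure_mono h6

lemma pl_bm {A B C : Set ℝ} (hA : MeasurableSet A) (hB : MeasurableSet B)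
    (hAn : A.Nonempty) (hBn : B.Nonempty)
    (h : ∀ a ∈ A, ∀ b ∈ B, (1 / 2 : ℝ) * (a + b) ∈ C) :
    volume A + volume B ≤ 2 * volume C := by
  have hT : volume ((fun x => (1 / 2 : ℝ) * x) ⁻¹' C) = 2 * volume C := by
    rw [Real.volume_preimage_mul_left (by norm_num)]
    norm_num
  rw [← hT]
  obtain ⟨a0, ha0⟩ := hAn
  obtain ⟨b0, hb0⟩ := hBn
  rw [hA.measure_eq_iSup_isCompact, hB.measure_eq_iSup_isCompact]
  simp only [iSup_and']
  refine ENNReal.biSup_add_biSup_le' ⟨∅, Set.empty_subset _, isCompact_empty⟩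
    ⟨∅, Set.empty_subset _, isCompact_empty⟩ ?_
  rintro K ⟨hKA, hK⟩ L ⟨hLB, hL⟩
  calc volume K + volume L ≤ volume (insert a0 K) + volume (insert b0 L) := by
        gcongr <;> exact Set.subset_insert _ _
    _ ≤ _ := by
      apply pl_bm_compact (hK.insert a0) (hL.insert b0) (Set.insert_nonempty _ _)
        (Set.insert_nonempty _ _)
      intro a ha b hb
      refine h a ?_ b ?_
      · exact Set.insert_subset ha0 hKA ha
      · exact Set.insert_subset hb0 hLB hb

lemma pl_one_real {f g h : ℝ → ℝ} (hf : Measurable f) (hg : Measurable g) (hh : Measurable h)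
    (hf0 : ∀ x, 0 ≤ f x) (hg0 : ∀ x, 0 ≤ g x) (hh0 : ∀ x, 0 ≤ h x)
    (hf1 : ∀ x, f x ≤ 1) (hg1 : ∀ x, g x ≤ 1)
    (hfs : ∀ t < 1, ∃ x, t < f x) (hgs : ∀ t < 1, ∃ x, t < g x)
    (H : ∀ x y, f x * g y ≤ h ((1 / 2 : ℝ) * (x + y)) ^ 2) :
    (∫⁻ x, ENNReal.ofReal (f x)) + (∫⁻ x, ENNReal.ofReal (g x)) ≤
      2 * ∫⁻ x, ENNReal.ofReal (h x) := by
  rw [lintegral_eq_lintegral_meas_lt volume (Filter.Eventually.of_forall hf0) hf.aemeasurable,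
    lintegral_eq_lintegral_meas_lt volume (Filter.Eventually.of_forall hg0) hg.aemeasurable,
    lintegral_eq_lintegral_meas_lt volume (Filter.Eventually.of_forall hh0) hh.aemeasurable]
  have hm : ∀ k : ℝ → ℝ, Measurable fun t : ℝ => volume {a | t < k a} := by
    intro k
    apply Antitone.measurable
    intro s t hst
    exact measure_mono fun a ha => lt_of_le_of_lt hst ha
  rw [← lintegral_add_left (hm f), ← lintegral_const_mul _ (hm h)]
  apply lintegral_mono_ae
  filter_upwards [ae_restrict_mem measurableSet_Ioi] with t ht
  have ht0 : (0 : ℝ) < t := ht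
  rcases lt_or_ge t 1 with h1 | h1
  · apply pl_bm (measurableSet_lt measurable_const hf) (measurableSet_lt measurable_const hg)
      (hfs t h1) (hgs t h1)
    intro a ha b hb
    have ha' : t < f a := ha
    have hb' : t < g b := hb
    have := H a b
    have h3 : t ^ 2 < h ((1 / 2 : ℝ) * (a + b)) ^ 2 := by nlinarith
    exact lt_of_pow_lt_pow_left₀ 2 (hh0 _) h3
  · have e1 : {a | t < f a} = ∅ := by
      ext a; simp; linarith [hf1 a]
    have e2 : {a | t < g a} = ∅ := by
      ext a; simp; linarith [hg1 a]
    rw [e1, e2]; simp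


lemma pl_amgm (a b : ENNReal) : 4 * (a * b) ≤ (a + b) ^ 2 := by
  by_cases ha : a = ⊤
  · simp [ha]
  by_cases hb : b = ⊤
  · simp [hb]
  lift a to NNReal using ha
  lift b to NNReal using hb
  norm_cast
  rw [← NNReal.coe_le_coe]
  push_cast
  nlinarith [sq_nonneg ((a : ℝ) - b)]

lemma pl_one_bdd {f g h : ℝ → ENNReal} (hf : Measurable f) (hg : Measurable g)
    (hh : Measurable h) {n m : ENNReal} (hn : n ≠ ⊤) (hm : m ≠ ⊤)
    (hfn : ∀ x, f x ≤ n) (hgm : ∀ x, g x ≤ m)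
    (H : ∀ x y, f x * g y ≤ h ((1 / 2 : ℝ) • (x + y)) ^ 2) :
    (∫⁻ x, f x) * (∫⁻ x, g x) ≤ (∫⁻ x, h x) ^ 2 := by
  set M := ⨆ x, f x with hM
  set N := ⨆ x, g x with hN
  have hfM : ∀ x, f x ≤ M := fun x => le_iSup f x
  have hgN : ∀ x, g x ≤ N := fun x => le_iSup g x
  have hMt : M ≠ ⊤ := ne_top_of_le_ne_top hn (iSup_le hfn)
  have hNt : N ≠ ⊤ := ne_top_of_le_ne_top hm (iSup_le hgm)
  by_cases hM0 : M = 0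
  · have : ∀ x, f x = 0 := fun x => le_antisymm (hM0 ▸ hfM x) bot_le
    simp [this]
  by_cases hN0 : N = 0
  · have : ∀ x, g x = 0 := fun x => le_antisymm (hN0 ▸ hgN x) bot_le
    simp [this]
  set c : ENNReal := (M * N) ^ (1 / 2 : ℝ) with hc
  have hMN0 : M * N ≠ 0 := mul_ne_zero hM0 hN0
  have hMNt : M * N ≠ ⊤ := ENNReal.mul_ne_top hMt hNt
  have hc2 : c ^ 2 = M * N := by
    rw [hc, ← ENNReal.rpow_natCast, ← ENNReal.rpow_mul]; norm_num
  have hc0 : c ≠ 0 := by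
    intro h0; rw [h0] at hc2; exact hMN0 (by rw [← hc2]; simp)
  have hct : c ≠ ⊤ := by
    intro h0; rw [h0] at hc2; exact hMNt (by rw [← hc2]; simp)
  have hf1 : ∀ x, f x / M ≤ 1 := fun x => ENNReal.div_le_of_le_mul (by simpa using hfM x)
  have hg1 : ∀ x, g x / N ≤ 1 := fun x => ENNReal.div_le_of_le_mul (by simpa using hgN x)
  have tR : ∀ {a : ENNReal}, a ≤ 1 → a.toReal ≤ 1 := by
    intro a ha
    simpa using ENNReal.toReal_mono ENNReal.one_ne_top ha
  have nT : ∀ {a : ENNReal}, a ≤ 1 → a ≠ ⊤ := fun ha => ne_top_of_le_ne_top ENNReal.one_ne_top ha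
  have sup : ∀ (k : ℝ → ENNReal) (P : ENNReal), P = ⨆ x, k x → P ≠ 0 → P ≠ ⊤ →
      (∀ x, k x / P ≤ 1) → ∀ t < (1 : ℝ), ∃ x, t < (k x / P).toReal := by
    intro k P hP hP0 hPt hk t ht
    by_contra hcon
    push Not at hcon
    have h0 : 0 ≤ t := le_trans ENNReal.toReal_nonneg (hcon 0)
    have h1 : P ≤ ENNReal.ofReal t * P := by
      conv_lhs => rw [hP]
      apply iSup_le
      intro x
      have := (ENNReal.le_ofReal_iff_toReal_le (nT (hk x)) h0).2 (hcon x)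
      exact (ENNReal.div_le_iff hP0 hPt).1 this
    have h2 : ENNReal.ofReal t * P < 1 * P := by
      apply ENNReal.mul_lt_mul_left hP0 hPt
      simpa using ht
    rw [one_mul] at h2
    exact absurd h1 (not_le.2 h2)
  have key := pl_one_real (f := fun x => (f x / M).toReal) (g := fun x => (g x / N).toReal)
    (h := fun x => (min (h x / c) 1).toReal)
    (hf.div_const _).ennreal_toReal (hg.div_const _).ennreal_toReal
    ((hh.div_const _).min measurable_const).ennreal_toReal
    (fun _ => ENNReal.toReal_nonneg) (fun _ => ENNReal.toReal_nonneg)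
    (fun _ => ENNReal.toReal_nonneg) (fun x => tR (hf1 x)) (fun x => tR (hg1 x))
    (sup f M hM hM0 hMt hf1) (sup g N hN hN0 hNt hg1) ?_
  · simp_rw [ENNReal.ofReal_toReal (nT (hf1 _)), ENNReal.ofReal_toReal (nT (hg1 _)),
      ENNReal.ofReal_toReal (nT (min_le_right _ _))] at key
    have key2 : (∫⁻ x, f x) / M + (∫⁻ x, g x) / N ≤ 2 * ((∫⁻ x, h x) / c) := by
      simp only [div_eq_mul_inv] at key ⊢
      rw [lintegral_mul_const _ hf, lintegral_mul_const _ hg] at key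
      refine key.trans ?_
      rw [← lintegral_mul_const _ hh]
      gcongr
      exact min_le_left _ _
    have key3 : 4 * ((∫⁻ x, f x) / M * ((∫⁻ x, g x) / N)) ≤ 4 * ((∫⁻ x, h x) / c) ^ 2 := by
      calc _ ≤ _ := pl_amgm _ _
        _ ≤ _ := pow_le_pow_left' key2 2
        _ = _ := by rw [mul_pow]; norm_num
    rw [ENNReal.mul_le_mul_iff_right (by norm_num) (by norm_num)] at key3
    have e1 : ∫⁻ x, f x = (∫⁻ x, f x) / M * M := (ENNReal.div_mul_cancel hM0 hMt).symm
    have e2 : ∫⁻ x, g x = (∫⁻ x, g x) / N * N := (ENNReal.div_mul_cancel hN0 hNt).symm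
    have e3 : ∫⁻ x, h x = (∫⁻ x, h x) / c * c := (ENNReal.div_mul_cancel hc0 hct).symm
    rw [e1, e2, e3, mul_pow, hc2]
    calc _ = ((∫⁻ x, f x) / M * ((∫⁻ x, g x) / N)) * (M * N) := by ring
      _ ≤ _ := by gcongr
  · intro x y
    have hmin : f x / M * (g y / N) ≤ (min (h ((1 / 2 : ℝ) * (x + y)) / c) 1) ^ 2 := by
      rcases le_total (h ((1 / 2 : ℝ) * (x + y)) / c) 1 with h1 | h1
      · rw [min_eq_left h1]
        have := H x y
        rw [smul_eq_mul] at this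
        rw [div_eq_mul_inv, div_eq_mul_inv, div_eq_mul_inv, mul_pow, ← ENNReal.inv_pow, hc2,
          ENNReal.mul_inv (Or.inl hM0) (Or.inl hMt)]
        calc _ = f x * g y * (M⁻¹ * N⁻¹) := by ring
          _ ≤ _ := by gcongr
      · rw [min_eq_right h1]
        simpa using mul_le_mul' (hf1 x) (hg1 y)
    have := ENNReal.toReal_mono (by
      apply ENNReal.pow_ne_top
      exact nT (min_le_right _ _)) hmin
    simpa only [ENNReal.toReal_mul, ENNReal.toReal_pow] using this

/-- The midpoint Prékopa Leindler property of a measure. -/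
def PLProp {E : Type*} [AddCommGroup E] [Module ℝ E] [MeasurableSpace E]
    (μ : Measure E) : Prop :=
  ∀ f g h : E → ENNReal, Measurable f → Measurable g → Measurable h →
    (∀ x y, f x * g y ≤ h ((1 / 2 : ℝ) • (x + y)) ^ 2) →
    (∫⁻ x, f x ∂μ) * (∫⁻ x, g x ∂μ) ≤ (∫⁻ x, h x ∂μ) ^ 2

lemma pl_trunc (f : ℝ → ENNReal) (hf : Measurable f) :
    ∫⁻ x, f x = ⨆ n : ℕ, ∫⁻ x, min (f x) n := by
  rw [← lintegral_iSup (fun n => hf.min measurable_const)]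
  · congr 1
    ext x
    apply le_antisymm
    · by_cases hx : f x = ⊤
      · simp [hx, ENNReal.iSup_natCast]
      · obtain ⟨n, hn⟩ := ENNReal.exists_nat_gt hx
        exact le_iSup_of_le n (le_min le_rfl hn.le)
    · exact iSup_le fun n => min_le_left _ _
  · intro n m hnm x
    exact min_le_min le_rfl (by exact_mod_cast hnm)

lemma pl_one : PLProp (volume : Measure ℝ) := by
  intro f g h hf hg hh H
  rw [pl_trunc f hf, pl_trunc g hg, ENNReal.iSup_mul]
  apply iSup_le
  intro n
  rw [ENNReal.mul_iSup]
  apply iSup_le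
  intro m
  apply pl_one_bdd (hf.min measurable_const) (hg.min measurable_const) hh
    (ENNReal.natCast_ne_top n) (ENNReal.natCast_ne_top m)
    (fun _ => min_le_right _ _) (fun _ => min_le_right _ _)
  intro x y
  exact (mul_le_mul' (min_le_left _ _) (min_le_left _ _)).trans (H x y)

lemma PLProp.prod {E F : Type*} [AddCommGroup E] [Module ℝ E] [MeasurableSpace E]
    [AddCommGroup F] [Module ℝ F] [MeasurableSpace F] {μ : Measure E} {ν : Measure F}
    [SFinite μ] [SFinite ν] (hμ : PLProp μ) (hν : PLProp ν) : PLProp (μ.prod ν) := by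
  intro f g h hf hg hh H
  rw [lintegral_prod _ hf.aemeasurable, lintegral_prod _ hg.aemeasurable,
    lintegral_prod _ hh.aemeasurable]
  apply hμ _ _ _ hf.lintegral_prod_right' hg.lintegral_prod_right' hh.lintegral_prod_right'
  intro x x'
  apply hν _ _ _ (hf.comp measurable_prodMk_left) (hg.comp measurable_prodMk_left)
    (hh.comp measurable_prodMk_left)
  intro y y'
  exact H (x, y) (x', y')

lemma PLProp.transfer {E F : Type*} [AddCommGroup E] [Module ℝ E] [MeasurableSpace E]
    [AddCommGroup F] [Module ℝ F] [MeasurableSpace F] {μ : Measure E} {ν : Measure F}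
    (hμ : PLProp μ) {T : E → F} (hT : MeasurePreserving T μ ν)
    (hmid : ∀ x y, T ((1 / 2 : ℝ) • (x + y)) = (1 / 2 : ℝ) • (T x + T y)) : PLProp ν := by
  intro f g h hf hg hh H
  rw [← hT.lintegral_comp hf, ← hT.lintegral_comp hg, ← hT.lintegral_comp hh]
  apply hμ _ _ _ (hf.comp hT.measurable) (hg.comp hT.measurable) (hh.comp hT.measurable)
  intro x y
  simp only [Function.comp, hmid]
  exact H _ _

lemma pl_pi (n : ℕ) : PLProp (volume : Measure (Fin n → ℝ)) := by
  induction n with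
  | zero =>
    intro f g h hf hg hh H
    rw [Measure.volume_pi_eq_dirac (default : Fin 0 → ℝ)]
    rw [lintegral_dirac' _ hf, lintegral_dirac' _ hg, lintegral_dirac' _ hh]
    convert! H default default using 3
  | succ n ih =>
    have hp : PLProp (volume : Measure (ℝ × (Fin n → ℝ))) := pl_one.prod ih
    refine hp.transfer
      (volume_preserving_piFinSuccAbove (fun _ : Fin (n + 1) => ℝ) 0).symm ?_
    intro x y
    ext i
    refine Fin.cases ?_ (fun j => ?_) i
    · simp [MeasurableEquiv.piFinSuccAbove]
      ring
    · simp [MeasurableEquiv.piFinSuccAbove]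
      ring

lemma pl_euclidean (n : ℕ) : PLProp (volume : Measure (EuclideanSpace ℝ (Fin n))) :=
  (pl_pi n).transfer (PiLp.volume_preserving_toLp (Fin n)) (fun x y => by
    simp [WithLp.toLp_add, WithLp.toLp_smul])


lemma lin_exp_lower {x : ℝ} (hx : |x| ≤ 1) : 1 + x + x ^ 2 / 2 - |x| ^ 3 ≤ exp x := by
  have h := Real.exp_bound hx (n := 3) (by norm_num)
  have h2 := (abs_le.1 h).1
  simp [Finset.sum_range_succ, Nat.factorial] at h2
  have h3 : 0 ≤ |x| ^ 3 := by positivity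
  nlinarith

lemma lin_exp_upper {x : ℝ} (hx : |x| ≤ 1) : exp x ≤ 1 + x + x ^ 2 := by
  have h := (abs_le.1 (Real.abs_exp_sub_one_sub_id_le hx)).2
  linarith

/-- Linearization of the exponential inequality. -/
lemma lin_var {Ω : Type*} [MeasurableSpace Ω] (ν : Measure Ω) [IsFiniteMeasure ν]
    {F q : Ω → ℝ} (hF : Measurable F) (hq : Measurable q) {B : ℝ} (hB : 0 < B)
    (hFB : ∀ᵐ x ∂ν, |F x| ≤ B) (hqB : ∀ᵐ x ∂ν, |q x| ≤ B)
    {ε₀ : ℝ} (hε₀ : 0 < ε₀)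
    (H : ∀ ε, 0 < ε → ε < ε₀ → (∫ x, exp (ε * F x) ∂ν) * (∫ x, exp (-(ε * F x)) ∂ν) ≤
      (∫ x, exp (ε ^ 2 * q x / 2) ∂ν) ^ 2) :
    ν.real Set.univ * (∫ x, F x ^ 2 ∂ν) - (∫ x, F x ∂ν) ^ 2 ≤
      ν.real Set.univ * ∫ x, q x ∂ν := by
  set N := ν.real Set.univ with hN
  set I1 := ∫ x, F x ∂ν
  set I2 := ∫ x, F x ^ 2 ∂ν
  set J := ∫ x, q x ∂ν
  have bint : ∀ (k : Ω → ℝ), Measurable k → ∀ C : ℝ, (∀ᵐ x ∂ν, |k x| ≤ C) → Integrable k ν := by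
    intro k hk C hC
    exact Integrable.of_bound hk.aestronglyMeasurable C hC
  have iF : Integrable F ν := bint F hF B hFB
  have iq : Integrable q ν := bint q hq B hqB
  have iF2 : Integrable (fun x => F x ^ 2) ν := by
    refine bint _ (hF.pow_const 2) (B ^ 2) ?_
    filter_upwards [hFB] with x hx
    rw [abs_pow]; gcongr
  rcases eq_or_lt_of_le (show 0 ≤ N from measureReal_nonneg) with h0 | hNpos
  · rw [← h0]; nlinarith [sq_nonneg I1]
  set c := B ^ 3 * N
  set c' := B ^ 2 / 4 * N
  set S : ℝ → ℝ := fun ε => N * I2 - I1 ^ 2 - N * J - 2 * N * ε * c + ε ^ 2 * (I2 / 2 - ε * c) ^ 2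
    - 2 * N * ε ^ 2 * c' - ε ^ 2 * (J / 2 + ε ^ 2 * c') ^ 2 with hS
  have hS0 : Filter.Tendsto S (nhdsWithin 0 (Set.Ioi 0)) (nhds (N * I2 - I1 ^ 2 - N * J)) := by
    have : Continuous S := by rw [hS]; fun_prop
    have h2 := this.tendsto 0
    have h3 : S 0 = N * I2 - I1 ^ 2 - N * J := by simp [hS]
    rw [h3] at h2
    exact h2.mono_left nhdsWithin_le_nhds
  set a' : ℝ → ℝ := fun ε => N + ε * I1 + ε ^ 2 * I2 / 2 - ε ^ 3 * c with ha'
  have ha'0 : ∀ᶠ ε in nhdsWithin 0 (Set.Ioi 0), 0 < a' ε := by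
    have : Continuous a' := by rw [ha']; fun_prop
    have h2 := this.tendsto 0
    have h3 : a' 0 = N := by simp [ha']
    rw [h3] at h2
    exact (h2.mono_left nhdsWithin_le_nhds).eventually (lt_mem_nhds hNpos)
  have hsm : ∀ᶠ ε in nhdsWithin (0 : ℝ) (Set.Ioi 0), ε < min ε₀ (min 1 (1 / B)) :=
    (gt_mem_nhds (show (0 : ℝ) < min ε₀ (min 1 (1 / B)) by positivity)).filter_mono
      nhdsWithin_le_nhds
  have hev : ∀ᶠ ε in nhdsWithin 0 (Set.Ioi 0), S ε ≤ 0 := by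
    filter_upwards [ha'0, hsm, self_mem_nhdsWithin] with ε h1 h2 h3
    have hε : (0 : ℝ) < ε := h3
    obtain ⟨e1, e2⟩ := lt_min_iff.1 h2
    obtain ⟨e2, e3⟩ := lt_min_iff.1 e2
    have e4 : ε * B ≤ 1 := by
      have := (lt_div_iff₀ hB).1 e3; linarith
    have hmain := H ε hε e1
    have low : ∀ τ : ℝ, |τ| = ε → N + τ * I1 + ε ^ 2 * I2 / 2 - ε ^ 3 * c ≤
        ∫ x, exp (τ * F x) ∂ν := by
      intro τ hτ
      have hτ2 : τ ^ 2 = ε ^ 2 := by rw [← hτ, sq_abs]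
      have i1 : Integrable (fun x => exp (τ * F x)) ν := by
        refine bint _ (by fun_prop) (exp 1) ?_
        filter_upwards [hFB] with x hx
        rw [abs_of_pos (exp_pos _)]
        apply exp_le_exp.2
        calc τ * F x ≤ |τ * F x| := le_abs_self _
          _ = ε * |F x| := by rw [abs_mul, hτ]
          _ ≤ ε * B := by gcongr
          _ ≤ 1 := e4
      have i2 : Integrable (fun x => 1 + τ * F x + ε ^ 2 / 2 * F x ^ 2 - ε ^ 3 * B ^ 3) ν :=
        (((integrable_const 1).add (iF.const_mul τ)).add (iF2.const_mul _)).sub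
          (integrable_const _)
      have e : ∫ x, (1 + τ * F x + ε ^ 2 / 2 * F x ^ 2 - ε ^ 3 * B ^ 3) ∂ν
          = N + τ * I1 + ε ^ 2 * I2 / 2 - ε ^ 3 * c := by
        have j1 : Integrable (fun x => 1 + τ * F x) ν := (integrable_const 1).add (iF.const_mul τ)
        have j2 : Integrable (fun x => 1 + τ * F x + ε ^ 2 / 2 * F x ^ 2) ν :=
          j1.add (iF2.const_mul _)
        rw [integral_sub j2 (integrable_const _), integral_add j1 (iF2.const_mul _),
          integral_add (integrable_const 1) (iF.const_mul τ), integral_const, integral_const, integral_const_mul, integral_const_mul]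
        simp only [smul_eq_mul, c]
        ring
      rw [← e]
      apply integral_mono_ae i2 i1
      filter_upwards [hFB] with x hx
      have hb : |τ * F x| ≤ ε * B := by
        rw [abs_mul, hτ]; gcongr
      have := lin_exp_lower (hb.trans e4)
      have h5 : |τ * F x| ^ 3 ≤ ε ^ 3 * B ^ 3 := by
        rw [← mul_pow]; gcongr
      have h6 : (τ * F x) ^ 2 = ε ^ 2 * F x ^ 2 := by rw [mul_pow, hτ2]
      rw [h6] at this
      linarith
    have l1 := low ε (abs_of_pos hε)
    have l2 := low (-ε) (by rw [abs_neg, abs_of_pos hε])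
    have l2' : ∫ x, exp (-(ε * F x)) ∂ν = ∫ x, exp (-ε * F x) ∂ν := by simp [neg_mul]
    rw [← l2'] at l2
    have up : ∫ x, exp (ε ^ 2 * q x / 2) ∂ν ≤ N + ε ^ 2 * J / 2 + ε ^ 4 * c' := by
      have hb : ∀ᵐ x ∂ν, |ε ^ 2 * q x / 2| ≤ 1 ∧ |ε ^ 2 * q x / 2| ≤ ε ^ 2 * B / 2 := by
        filter_upwards [hqB] with x hx
        have : |ε ^ 2 * q x / 2| ≤ ε ^ 2 * B / 2 := by
          rw [abs_div, abs_mul, abs_of_pos (by positivity : 0 < ε ^ 2)]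
          simp only [Nat.abs_ofNat]
          gcongr
        refine ⟨this.trans ?_, this⟩
        nlinarith
      have i1 : Integrable (fun x => exp (ε ^ 2 * q x / 2)) ν := by
        refine bint _ (by fun_prop) (exp 1) ?_
        filter_upwards [hb] with x hx
        rw [abs_of_pos (exp_pos _)]
        exact exp_le_exp.2 ((le_abs_self _).trans hx.1)
      have e : ∫ x, (1 + ε ^ 2 / 2 * q x + ε ^ 4 * (B ^ 2 / 4)) ∂ν
          = N + ε ^ 2 * J / 2 + ε ^ 4 * c' := by
        have j1 : Integrable (fun x => 1 + ε ^ 2 / 2 * q x) ν :=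
          (integrable_const 1).add (iq.const_mul _)
        rw [integral_add j1 (integrable_const _),
          integral_add (integrable_const 1) (iq.const_mul _),
          integral_const, integral_const, integral_const_mul]
        simp only [smul_eq_mul, c']
        ring
      rw [← e]
      apply integral_mono_ae i1
        (((integrable_const 1).add (iq.const_mul _)).add (integrable_const _))
      filter_upwards [hb] with x hx
      have h5 := lin_exp_upper hx.1
      have h6 : (ε ^ 2 * q x / 2) ^ 2 ≤ (ε ^ 2 * B / 2) ^ 2 := by
        rw [← sq_abs]
        gcongr
        exact hx.2
      change _ ≤ 1 + ε ^ 2 / 2 * q x + ε ^ 4 * (B ^ 2 / 4)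
      nlinarith
    have hup0 : 0 ≤ ∫ x, exp (ε ^ 2 * q x / 2) ∂ν := integral_nonneg fun x => (exp_pos _).le
    have hn0 : 0 ≤ ∫ x, exp (-(ε * F x)) ∂ν := integral_nonneg fun x => (exp_pos _).le
    have fin : (N + ε * I1 + ε ^ 2 * I2 / 2 - ε ^ 3 * c) *
        (N + -ε * I1 + ε ^ 2 * I2 / 2 - ε ^ 3 * c) ≤ (N + ε ^ 2 * J / 2 + ε ^ 4 * c') ^ 2 := by
      calc _ ≤ (N + ε * I1 + ε ^ 2 * I2 / 2 - ε ^ 3 * c) * ∫ x, exp (-(ε * F x)) ∂ν :=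
            mul_le_mul_of_nonneg_left l2 h1.le
        _ ≤ _ := mul_le_mul_of_nonneg_right l1 hn0
        _ ≤ _ := hmain
        _ ≤ _ := pow_le_pow_left₀ hup0 up 2
    have : ε ^ 2 * S ε ≤ 0 := by
      have : ε ^ 2 * S ε = (N + ε * I1 + ε ^ 2 * I2 / 2 - ε ^ 3 * c) *
        (N + -ε * I1 + ε ^ 2 * I2 / 2 - ε ^ 3 * c) - (N + ε ^ 2 * J / 2 + ε ^ 4 * c') ^ 2 := by
        simp only [hS]; ring
      linarith
    by_contra hcon
    push Not at hcon
    have : 0 < ε ^ 2 * S ε := by positivity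
    linarith
  have := le_of_tendsto hS0 hev
  linarith

lemma pw_bound {E : Type*} [NormedAddCommGroup E] [NormedSpace ℝ E]
    {K : Set E} (hK : IsCompact K) (hKc : Convex ℝ K)
    {W F κ G : E → ℝ} (hFc : Continuous F) (hκc : Continuous κ) (hGc : Continuous G)
    (hκ : ∀ x, 0 < κ x) (hG : ∀ x, 0 ≤ G x)
    {k a δ : ℝ} (hk : 0 < k) (ha : 0 < a) (hδ : 0 < δ)
    (hW : ∀ x y c, (∀ p ∈ segment ℝ x y, c ≤ κ p) → ∀ l, 0 ≤ l → l ≤ 1 →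
      W (l • x + (1 - l) • y) + l * (1 - l) / 2 * c * ‖x - y‖ ^ 2 ≤ l * W x + (1 - l) * W y)
    (hF : ∀ x y c, (∀ p ∈ segment ℝ x y, G p ≤ c) → F x - F y ≤ c * ‖x - y‖) :
    ∃ ε₀ > 0, ∀ ε, 0 < ε → ε < ε₀ → ∀ x ∈ K, ∀ y ∈ K, ∀ s r, a < s → a < r →
      ε * (F x - F y) - (s * W x + r * W y - (s + r) * W ((s / (s + r)) • x + (r / (s + r)) • y))
        + k * log (s * r / ((s + r) / 2) ^ 2) ≤
      ε ^ 2 * (G ((s / (s + r)) • x + (r / (s + r)) • y) ^ 2 /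
        κ ((s / (s + r)) • x + (r / (s + r)) • y) / ((s + r) / 2) + δ) := by
  rcases K.eq_empty_or_nonempty with hKe | hKn
  · exact ⟨1, one_pos, by simp [hKe]⟩
  obtain ⟨B, hB⟩ := hK.exists_bound_of_continuousOn hFc.continuousOn
  obtain ⟨G₀, hG₀⟩ := hK.exists_bound_of_continuousOn hGc.continuousOn
  obtain ⟨xm, hxm, hκm⟩ := hK.exists_isMinOn hKn hκc.continuousOn
  set κ₀ := κ xm
  have hκ₀ : 0 < κ₀ := hκ xm
  have hκK : ∀ x ∈ K, κ₀ ≤ κ x := fun x hx => hκm hx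
  set B' := |B| + 1
  have hB' : 0 < B' := by positivity
  have hFB : ∀ x ∈ K, |F x| ≤ B' := fun x hx => (hB x hx).trans (by
    have := le_abs_self B; simp only [B']; linarith)
  have hGK : ∀ x ∈ K, G x ≤ G₀ := fun x hx => (le_abs_self _).trans (hG₀ x hx)
  have hu : UniformContinuousOn (fun p : E × E => G p.1 ^ 2 / κ p.2) (K ×ˢ K) := by
    apply (hK.prod hK).uniformContinuousOn_of_continuous
    apply Continuous.continuousOn
    exact ((hGc.comp continuous_fst).pow 2).div (hκc.comp continuous_snd) fun p => (hκ _).ne'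
  obtain ⟨ρ, hρ, hu⟩ := Metric.uniformContinuousOn_iff.1 hu (δ * a) (by positivity)
  refine ⟨min 1 (min (k / (4 * B')) (min (k * κ₀ * a / (2 * (G₀ ^ 2 + 1)))
    (a * κ₀ * ρ ^ 2 / (16 * B')))), by positivity, ?_⟩
  intro ε hε hεlt x hx y hy s r hs hr
  obtain ⟨h1, hεlt⟩ := lt_min_iff.1 hεlt
  obtain ⟨h2, hεlt⟩ := lt_min_iff.1 hεlt
  obtain ⟨h3, h4⟩ := lt_min_iff.1 hεlt
  rw [lt_div_iff₀ (by positivity)] at h2 h3 h4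
  have hs0 : 0 < s := ha.trans hs
  have hr0 : 0 < r := ha.trans hr
  have hl : r / (s + r) = 1 - s / (s + r) := by field_simp; ring
  set l := s / (s + r) with hldef
  have hl0 : 0 ≤ l := by positivity
  have hl1 : l ≤ 1 := by
    rw [hldef, div_le_one (by positivity)]; linarith
  rw [hl]
  set z := l • x + (1 - l) • y with hz
  set σ := (s + r) / 2 with hσ
  have hσ0 : 0 < σ := by positivity
  have hσa : a < σ := by rw [hσ]; linarith
  set p := s * r / σ ^ 2 with hp
  have hp0 : 0 < p := by positivity
  have hlp : (s + r) * (l * (1 - l) / 2) = σ * p / 4 := by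
    rw [← hl, hldef, hp, hσ]; field_simp
    ring
  have hpen : k * log p ≤ -(k * (1 - p)) := by
    have := log_le_sub_one_of_pos hp0
    nlinarith
  have hp1 : p ≤ 1 := by
    rw [hp, div_le_one (by positivity), hσ]; nlinarith [sq_nonneg (s - r)]
  have hseg : ∀ q ∈ segment ℝ x y, q ∈ K := fun q hq => hKc.segment_subset hx hy hq
  have hzs : z ∈ segment ℝ x y := ⟨l, 1 - l, hl0, by linarith, by ring, rfl⟩
  have hzK : z ∈ K := hseg z hzs
  have hdef : ∀ c, (∀ q ∈ segment ℝ x y, c ≤ κ q) →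
      σ * p / 4 * c * ‖x - y‖ ^ 2 ≤ s * W x + r * W y - (s + r) * W z := by
    intro c hc
    have := hW x y c hc l hl0 hl1
    have h5 := mul_le_mul_of_nonneg_left this (by positivity : 0 ≤ s + r)
    have e1 : (s + r) * (l * W x + (1 - l) * W y) = s * W x + r * W y := by
      rw [← hl, hldef]; field_simp
    rw [e1] at h5
    rw [← hlp]
    have e2 : (s + r) * (W z + l * (1 - l) / 2 * c * ‖x - y‖ ^ 2) = (s + r) * W z +
      (s + r) * (l * (1 - l) / 2) * c * ‖x - y‖ ^ 2 := by ring
    linarith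
  have hdef0 : σ * p / 4 * κ₀ * ‖x - y‖ ^ 2 ≤ s * W x + r * W y - (s + r) * W z :=
    hdef κ₀ fun q hq => hκK q (hseg q hq)
  have hdef00 : 0 ≤ σ * p / 4 * κ₀ * ‖x - y‖ ^ 2 := by positivity
  have hFd : F x - F y ≤ 2 * B' := by
    have e1 := (abs_le.1 (hFB x hx)).2
    have e2 := (abs_le.1 (hFB y hy)).1
    linarith
  have hFd' : ε * (F x - F y) ≤ ε * (2 * B') := by gcongr
  have hR0 : 0 ≤ ε ^ 2 * (G z ^ 2 / κ z / σ + δ) := by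
    have := hκ z
    positivity
  have hkp : 0 ≤ k * (1 - p) := mul_nonneg hk.le (by linarith)
  rcases lt_or_ge p (1 / 2) with hp2 | hp2
  · have : k / 2 ≤ k * (1 - p) := by nlinarith only [hk, hp2]
    linarith
  rcases le_or_gt ρ ‖x - y‖ with hv | hv
  · have e1 : a * (1 / 2) ≤ σ * p := by gcongr
    have e2 : a / 8 * κ₀ * ρ ^ 2 ≤ σ * p / 4 * κ₀ * ‖x - y‖ ^ 2 := by
      have : a / 8 ≤ σ * p / 4 := by linarith
      gcongr
    have e3 : ε * (16 * B') = 8 * (ε * (2 * B')) := by ring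
    have e4 : a * κ₀ * ρ ^ 2 = 8 * (a / 8 * κ₀ * ρ ^ 2) := by ring
    have e5 : 0 < ε * (2 * B') := by positivity
    linarith
  have hsc : IsCompact (segment ℝ x y) := by
    rw [← convexHull_pair]
    exact (Set.toFinite _).isCompact_convexHull ℝ
  have hsn : (segment ℝ x y).Nonempty := ⟨z, hzs⟩
  obtain ⟨xs, hxs, hxsm⟩ := hsc.exists_isMaxOn hsn hGc.continuousOn
  obtain ⟨ys, hys, hysm⟩ := hsc.exists_isMinOn hsn hκc.continuousOn
  have hd := hdef (κ ys) fun q hq => hysm hq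
  have hf := hF x y (G xs) fun q hq => hxsm hq
  set A := G xs ^ 2 / κ ys / σ with hA
  have hκys := hκ ys
  have hGxs := hG xs
  have hdist : ∀ q ∈ segment ℝ x y, dist q z < ρ := by
    intro q hq
    refine lt_of_le_of_lt ?_ hv
    rw [← dist_eq_norm]
    obtain ⟨t, t', ht, ht', htt, rfl⟩ := hq
    have : t' = 1 - t := by linarith
    subst this
    rw [dist_eq_norm, dist_eq_norm, hz]
    have : t • x + (1 - t) • y - (l • x + (1 - l) • y) = (t - l) • (x - y) := by
      module
    rw [this, norm_smul]
    have : ‖t - l‖ ≤ 1 := by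
      rw [Real.norm_eq_abs, abs_le]; constructor <;> linarith
    exact mul_le_of_le_one_left (norm_nonneg _) this
  have hclose := hu (xs, ys) ⟨hseg _ hxs, hseg _ hys⟩ (z, z) ⟨hzK, hzK⟩ (by
    rw [Prod.dist_eq]; exact max_lt (hdist _ hxs) (hdist _ hys))
  simp only at hclose
  rw [Real.dist_eq] at hclose
  have hclose2 := (abs_lt.1 hclose).2
  have hAz : A ≤ G z ^ 2 / κ z / σ + δ := by
    rw [hA, div_add' _ _ _ hσ0.ne']
    gcongr
    have : δ * a ≤ δ * σ := by gcongr
    linarith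
  have hAb : ε ^ 2 * A ≤ k / 2 := by
    have e1 : A ≤ G₀ ^ 2 / κ₀ / a := by
      rw [hA]
      gcongr
      · exact hGK _ (hseg _ hxs)
      · exact hκK _ (hseg _ hys)
    have e2 : ε * (G₀ ^ 2 / κ₀ / a) ≤ k / 2 := by
      rw [div_div, mul_div_assoc', div_le_iff₀ (by positivity)]
      nlinarith only [h3, hε]
    have e3 : 0 ≤ A := by positivity
    have e4 : ε ^ 2 ≤ ε := by nlinarith only [hε, h1]
    calc ε ^ 2 * A ≤ ε * A := by gcongr
      _ ≤ ε * (G₀ ^ 2 / κ₀ / a) := by gcongr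
      _ ≤ _ := e2
  have hquad : ε * (G xs * ‖x - y‖) - σ * p / 4 * κ ys * ‖x - y‖ ^ 2 ≤ ε ^ 2 * A / p := by
    have e : ε ^ 2 * A / p - (ε * (G xs * ‖x - y‖) - σ * p / 4 * κ ys * ‖x - y‖ ^ 2) =
        (2 * ε * G xs - σ * p * κ ys * ‖x - y‖) ^ 2 / (4 * σ * p * κ ys) := by
      rw [hA]; field_simp; ring
    have : 0 ≤ (2 * ε * G xs - σ * p * κ ys * ‖x - y‖) ^ 2 / (4 * σ * p * κ ys) := by positivity
    linarith
  have hAp : ε ^ 2 * A / p ≤ ε ^ 2 * A + k * (1 - p) := by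
    rw [div_le_iff₀ hp0]
    have e1 : (k / 2 - ε ^ 2 * A) * (1 - p) ≥ 0 :=
      mul_nonneg (by linarith) (by linarith)
    have e2 : k * (1 - p) * (p - 1 / 2) ≥ 0 := mul_nonneg hkp (by linarith)
    linarith only [e1, e2]
  have hf' : ε * (F x - F y) ≤ ε * (G xs * ‖x - y‖) := by gcongr
  have hfin : ε ^ 2 * A ≤ ε ^ 2 * (G z ^ 2 / κ z / σ + δ) := by gcongr
  linarith


lemma cov_slice {d : ℕ} (g : EuclideanSpace ℝ (Fin d) → ENNReal) (hg : Measurable g)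
    {s : ℝ} (hs : 0 < s) :
    ∫⁻ y, g (s⁻¹ • y) = ENNReal.ofReal (s ^ d) * ∫⁻ x, g x := by
  have h := Measure.map_addHaar_smul (volume : Measure (EuclideanSpace ℝ (Fin d)))
    (inv_ne_zero hs.ne')
  rw [← lintegral_map hg (measurable_const_smul s⁻¹), h, lintegral_smul_measure]
  simp [abs_of_pos hs]

lemma cov_lift {d : ℕ} (g : EuclideanSpace ℝ (Fin d) × ℝ → ENNReal) (hg : Measurable g)
    (h0 : ∀ x s, s ≤ 0 → g (x, s) = 0) :
    ∫⁻ p : EuclideanSpace ℝ (Fin d) × ℝ, g (p.2⁻¹ • p.1, p.2) =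
      ∫⁻ p : EuclideanSpace ℝ (Fin d) × ℝ, ENNReal.ofReal (p.2 ^ d) * g p := by
  rw [Measure.volume_eq_prod]
  rw [lintegral_prod_symm _ (by fun_prop), lintegral_prod_symm _ (by fun_prop)]
  congr 1
  ext s
  rcases le_or_gt s 0 with hs | hs
  · simp [h0 _ s hs]
  · simp only
    rw [cov_slice (fun x => g (x, s)) (by fun_prop) hs, lintegral_const_mul _ (by fun_prop)]

/-- The lifted density. -/
noncomputable def liftDens {d : ℕ} (W : EuclideanSpace ℝ (Fin d) → ℝ) (b : ℝ)
    (p : EuclideanSpace ℝ (Fin d) × ℝ) : ℝ := p.2 ^ (b - 1) * exp (-(p.2 * W p.1))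

lemma lift_conv {d : ℕ} {W : EuclideanSpace ℝ (Fin d) → ℝ} (hW : Continuous W) {b k a : ℝ}
    (hk : k = b - 1 - d) (ha : 0 < a) {K : Set (EuclideanSpace ℝ (Fin d))} (hK : IsCompact K)
    {Θ : EuclideanSpace ℝ (Fin d) × ℝ → ℝ} (hΘ : Measurable Θ)
    (P : EuclideanSpace ℝ (Fin d) × ℝ → ENNReal)
    (hP : P = (K ×ˢ Set.Ioi a).indicator
      (fun p => ENNReal.ofReal (p.2 ^ k * exp (-(p.2 * W p.1) + Θ p)))) :
    Measurable P ∧ ∫⁻ p : EuclideanSpace ℝ (Fin d) × ℝ, P (p.2⁻¹ • p.1, p.2) =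
      ∫⁻ p, ENNReal.ofReal (exp (Θ p))
        ∂((volume.withDensity fun p => ENNReal.ofReal (liftDens W b p)).restrict
          (K ×ˢ Set.Ioi a)) := by
  have hD : MeasurableSet (K ×ˢ Set.Ioi a) := hK.measurableSet.prod measurableSet_Ioi
  have hWm : Measurable W := hW.measurable
  have hPm : Measurable P := by
    rw [hP]
    refine Measurable.indicator ?_ hD
    fun_prop
  refine ⟨hPm, ?_⟩
  rw [cov_lift P hPm, restrict_withDensity hD,
    lintegral_withDensity_eq_lintegral_mul _ (by unfold liftDens; fun_prop) (by fun_prop),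
    ← lintegral_indicator hD]
  · congr 1
    ext p
    rw [hP]
    by_cases hp : p ∈ K ×ˢ Set.Ioi a
    · rw [Set.indicator_of_mem hp, Set.indicator_of_mem hp]
      have hs : 0 < p.2 := ha.trans hp.2
      simp only [Pi.mul_apply, liftDens]
      rw [← ENNReal.ofReal_mul (by positivity), ← ENNReal.ofReal_mul (by positivity)]
      congr 1
      rw [exp_add, ← rpow_natCast]
      have : p.2 ^ (b - 1) = p.2 ^ (d : ℝ) * p.2 ^ k := by
        rw [← rpow_add hs, hk]; congr 1; ring
      rw [this]; ring
    · rw [Set.indicator_of_notMem hp, Set.indicator_of_notMem hp, mul_zero]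
  · intro x s hs
    rw [hP, Set.indicator_of_notMem]
    rintro ⟨-, h⟩
    have : a < s := h
    linarith

lemma bl_compact {d : ℕ} {K : Set (EuclideanSpace ℝ (Fin d))} (hK : IsCompact K)
    (hKc : Convex ℝ K)
    {W F κ G : EuclideanSpace ℝ (Fin d) → ℝ} (hWc : Continuous W)
    (hFc : Continuous F) (hκc : Continuous κ) (hGc : Continuous G)
    (hκ : ∀ x, 0 < κ x) (hG : ∀ x, 0 ≤ G x)
    {b a : ℝ} (hb : (d : ℝ) + 1 < b) (ha : 0 < a)
    (hW : ∀ x y c, (∀ p ∈ segment ℝ x y, c ≤ κ p) → ∀ l, 0 ≤ l → l ≤ 1 →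
      W (l • x + (1 - l) • y) + l * (1 - l) / 2 * c * ‖x - y‖ ^ 2 ≤ l * W x + (1 - l) * W y)
    (hF : ∀ x y c, (∀ p ∈ segment ℝ x y, G p ≤ c) → F x - F y ≤ c * ‖x - y‖)
    (ν : Measure (EuclideanSpace ℝ (Fin d) × ℝ)) [IsFiniteMeasure ν]
    (hν : ν = (volume.withDensity fun p => ENNReal.ofReal (liftDens W b p)).restrict
          (K ×ˢ Set.Ioi a)) :
    ν.real Set.univ * (∫ p, F p.1 ^ 2 ∂ν) - (∫ p, F p.1 ∂ν) ^ 2 ≤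
      ν.real Set.univ * ∫ p, G p.1 ^ 2 / κ p.1 / p.2 ∂ν := by
  have hD : MeasurableSet (K ×ˢ Set.Ioi a) := hK.measurableSet.prod measurableSet_Ioi
  have hae : ∀ᵐ p ∂ν, p ∈ K ×ˢ Set.Ioi a := by rw [hν]; exact ae_restrict_mem hD
  obtain ⟨B1, hB1⟩ := hK.exists_bound_of_continuousOn hFc.continuousOn
  obtain ⟨B2, hB2⟩ := hK.exists_bound_of_continuousOn (f := fun x => G x ^ 2 / κ x)
    ((hGc.pow 2).div hκc fun x => (hκ x).ne').continuousOn
  have hFm := hFc.measurable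
  have hGm := hGc.measurable
  have hκm := hκc.measurable
  set q : EuclideanSpace ℝ (Fin d) × ℝ → ℝ := fun p => G p.1 ^ 2 / κ p.1 / p.2 with hq
  have hqm : Measurable q := by rw [hq]; fun_prop
  have hqB : ∀ᵐ p ∂ν, |q p| ≤ |B2| / a := by
    filter_upwards [hae] with p hp
    have h1 := hB2 p.1 hp.1
    have h2 : a < p.2 := hp.2
    rw [hq]
    simp only
    rw [abs_div, abs_of_pos (ha.trans h2)]
    exact div_le_div₀ (abs_nonneg _) (h1.trans (le_abs_self _)) ha h2.le
  have hqi : Integrable q ν := Integrable.of_bound hqm.aestronglyMeasurable _ hqB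
  set N := ν.real Set.univ with hN
  have hN0 : 0 ≤ N := measureReal_nonneg
  have main : ∀ δ > 0, N * (∫ p, F p.1 ^ 2 ∂ν) - (∫ p, F p.1 ∂ν) ^ 2 ≤
      N * ∫ p, (q p + δ) ∂ν := by
    intro δ hδ
    obtain ⟨ε₀, hε₀, Hpw⟩ := pw_bound hK hKc hFc hκc hGc hκ hG (k := b - 1 - d) (by linarith)
      ha hδ hW hF
    have hQB : ∀ᵐ p ∂ν, |q p + δ| ≤ |B2| / a + δ := by
      filter_upwards [hqB] with p hp
      exact (abs_add_le _ _).trans (by rw [abs_of_pos hδ]; gcongr)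
    refine lin_var ν (F := fun p => F p.1) (q := fun p => q p + δ) (by fun_prop) (by fun_prop)
      (B := |B1| + (|B2| / a + δ)) (by positivity) ?_ ?_ hε₀ ?_
    · filter_upwards [hae] with p hp
      have h1 := hB1 p.1 hp.1
      rw [Real.norm_eq_abs] at h1
      have h2 : 0 ≤ |B2| / a + δ := by positivity
      linarith [le_abs_self B1]
    · filter_upwards [hQB] with p hp
      linarith [abs_nonneg B1]
    intro ε hε hεlt
    have conv : ∀ Θ : EuclideanSpace ℝ (Fin d) × ℝ → ℝ, Measurable Θ → _ := fun Θ hΘ =>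
      lift_conv hWc (k := b - 1 - d) (b := b) rfl ha hK hΘ _ rfl
    rw [← hν] at conv
    obtain ⟨m1, c1⟩ := conv (fun p => ε * F p.1) (by fun_prop)
    obtain ⟨m2, c2⟩ := conv (fun p => -(ε * F p.1)) (by fun_prop)
    obtain ⟨m3, c3⟩ := conv (fun p => ε ^ 2 * (q p + δ) / 2) (by fun_prop)
    have hpl : PLProp (volume : Measure (EuclideanSpace ℝ (Fin d) × ℝ)) :=
      (pl_euclidean d).prod pl_one
    have mm : Measurable fun p : EuclideanSpace ℝ (Fin d) × ℝ => (p.2⁻¹ • p.1, p.2) := by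
      fun_prop
    have key := hpl _ _ _ (m1.comp mm) (m2.comp mm) (m3.comp mm) ?_
    · simp only [Function.comp] at key
      rw [c1, c2, c3] at key
      have e : ∀ Θ : EuclideanSpace ℝ (Fin d) × ℝ → ℝ, Measurable Θ →
          ∫ p, exp (Θ p) ∂ν = (∫⁻ p, ENNReal.ofReal (exp (Θ p)) ∂ν).toReal := by
        intro Θ hΘ
        exact integral_eq_lintegral_of_nonneg_ae
          (Filter.Eventually.of_forall fun _ => (exp_pos _).le)
          (by fun_prop)
      rw [e _ (by fun_prop), e _ (by fun_prop), e _ (by fun_prop), ← ENNReal.toReal_mul,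
        ← ENNReal.toReal_pow]
      refine ENNReal.toReal_mono (ENNReal.pow_ne_top ?_) key
      have hi : Integrable (fun p => exp (ε ^ 2 * (q p + δ) / 2)) ν := by
        refine Integrable.of_bound (by fun_prop) (exp (ε ^ 2 * (|B2| / a + δ) / 2)) ?_
        filter_upwards [hQB] with p hp
        rw [Real.norm_eq_abs, abs_of_pos (exp_pos _), exp_le_exp]
        have := (le_abs_self _).trans hp
        gcongr
      exact (hi.lintegral_lt_top).ne
    · rintro ⟨y, s⟩ ⟨y', r⟩
      simp only [Function.comp]
      by_cases hp1 : (s⁻¹ • y, s) ∈ K ×ˢ Set.Ioi a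
      swap
      · rw [Set.indicator_of_notMem hp1, zero_mul]; exact bot_le
      by_cases hp2 : (r⁻¹ • y', r) ∈ K ×ˢ Set.Ioi a
      swap
      · rw [Set.indicator_of_notMem hp2, mul_zero]; exact bot_le
      obtain ⟨hx, hs⟩ := hp1
      obtain ⟨hx', hr⟩ := hp2
      have hs' : a < s := hs
      have hr' : a < r := hr
      have hs0 : 0 < s := ha.trans hs'
      have hr0 : 0 < r := ha.trans hr'
      have hmem1 : (s⁻¹ • y, s) ∈ K ×ˢ Set.Ioi a := ⟨hx, hs⟩
      have hmem2 : (r⁻¹ • y', r) ∈ K ×ˢ Set.Ioi a := ⟨hx', hr⟩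
      simp only at hx hx'
      have hP := Hpw ε hε hεlt _ hx _ hx' s r hs' hr'
      have e2 : ((1 / 2 : ℝ) • ((y, s) + (y', r))).2 = (s + r) / 2 := by
        simp; ring
      have e1 : ((1 / 2 : ℝ) • ((y, s) + (y', r))).2⁻¹ • ((1 / 2 : ℝ) • ((y, s) + (y', r))).1 =
          (s / (s + r)) • (s⁻¹ • y) + (r / (s + r)) • (r⁻¹ • y') := by
        rw [e2]
        simp only [Prod.smul_fst, Prod.fst_add, smul_smul, smul_add]
        congr 2 <;> field_simp
      rw [e1, e2]
      set x := s⁻¹ • y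
      set x' := r⁻¹ • y'
      set z := (s / (s + r)) • x + (r / (s + r)) • x' with hz
      have hzK : z ∈ K := hKc hx hx' (by positivity) (by positivity) (by field_simp)
      have hmem3 : (z, (s + r) / 2) ∈ K ×ˢ Set.Ioi a :=
        ⟨hzK, show a < (s + r) / 2 by linarith⟩
      rw [Set.indicator_of_mem hmem1, Set.indicator_of_mem hmem2, Set.indicator_of_mem hmem3,
        ← ENNReal.ofReal_mul (by positivity), ← ENNReal.ofReal_pow (by positivity)]
      apply ENNReal.ofReal_le_ofReal
      have hσ0 : 0 < (s + r) / 2 := by positivity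
      simp only [hq]
      rw [rpow_def_of_pos hs0, rpow_def_of_pos hr0, rpow_def_of_pos hσ0, ← exp_add, ← exp_add,
        ← exp_add, ← exp_add, ← exp_nat_mul, exp_le_exp]
      rw [log_div (by positivity) (by positivity), log_mul hs0.ne' hr0.ne', log_pow] at hP
      push_cast at hP ⊢
      linarith
  have hIntEq : ∀ δ, ∫ p, (q p + δ) ∂ν = (∫ p, q p ∂ν) + δ * N := by
    intro δ
    rw [integral_add hqi (integrable_const _), integral_const, smul_eq_mul, mul_comm]
  apply le_of_forall_pos_le_add
  intro δ hδ
  have h1 := main (δ / (N ^ 2 + 1)) (by positivity)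
  rw [hIntEq] at h1
  refine h1.trans ?_
  rw [mul_add]
  gcongr
  rw [div_mul_eq_mul_div, mul_div_assoc', div_le_iff₀ (by positivity)]
  nlinarith


lemma gamma_int {c w : ℝ} (hc : 0 < c) (hw : 0 < w) :
    Integrable (fun s : ℝ => s ^ (c - 1) * exp (-(s * w))) (volume.restrict (Set.Ioi 0)) ∧
    ∫ s in Set.Ioi (0 : ℝ), s ^ (c - 1) * exp (-(s * w)) = w ^ (-c) * Gamma c := by
  have h : ∫ s in Set.Ioi (0 : ℝ), s ^ (c - 1) * exp (-(s * w)) = w ^ (-c) * Gamma c := by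
    have := integral_rpow_mul_exp_neg_mul_Ioi hc hw
    simp_rw [mul_comm w] at this
    rw [this, one_div, inv_rpow hw.le, rpow_neg hw.le]
  refine ⟨?_, h⟩
  apply Integrable.of_integral_ne_zero
  rw [h]
  exact (mul_pos (rpow_pos_of_pos hw _) (Gamma_pos_of_pos hc)).ne'

lemma lift_int {d : ℕ} {W f : EuclideanSpace ℝ (Fin d) → ℝ} (hWc : Continuous W)
    (hW0 : ∀ x, 0 < W x) (hf : Measurable f) {c : ℝ} (hc : 0 < c)
    (hi : Integrable fun x => f x * W x ^ (-c)) :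
    IntegrableOn (fun p : EuclideanSpace ℝ (Fin d) × ℝ =>
      f p.1 * (p.2 ^ (c - 1) * exp (-(p.2 * W p.1)))) (Set.univ ×ˢ Set.Ioi 0) ∧
    ∫ p in (Set.univ ×ˢ Set.Ioi 0 : Set (EuclideanSpace ℝ (Fin d) × ℝ)),
      f p.1 * (p.2 ^ (c - 1) * exp (-(p.2 * W p.1))) = Gamma c * ∫ x, f x * W x ^ (-c) := by
  have hWm := hWc.measurable
  have hvol : (volume : Measure (EuclideanSpace ℝ (Fin d) × ℝ)).restrict
      (Set.univ ×ˢ Set.Ioi 0) = (volume : Measure (EuclideanSpace ℝ (Fin d))).prod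
        (volume.restrict (Set.Ioi (0 : ℝ))) := by
    rw [Measure.volume_eq_prod, ← Measure.prod_restrict, Measure.restrict_univ]
  have hI : Integrable (fun p : EuclideanSpace ℝ (Fin d) × ℝ =>
      f p.1 * (p.2 ^ (c - 1) * exp (-(p.2 * W p.1))))
      ((volume : Measure (EuclideanSpace ℝ (Fin d))).prod
        (volume.restrict (Set.Ioi (0 : ℝ)))) := by
    rw [integrable_prod_iff (by fun_prop)]
    refine ⟨Filter.Eventually.of_forall fun x => by
      simp only
      exact (gamma_int hc (hW0 x)).1.const_mul _, ?_⟩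
    have : (fun x => ∫ s in Set.Ioi (0 : ℝ), ‖f x * (s ^ (c - 1) * exp (-(s * W x)))‖) =
        fun x => ‖f x * W x ^ (-c)‖ * Gamma c := by
      ext x
      have : ∫ s in Set.Ioi (0 : ℝ), ‖f x * (s ^ (c - 1) * exp (-(s * W x)))‖ =
          ∫ s in Set.Ioi (0 : ℝ), ‖f x‖ * (s ^ (c - 1) * exp (-(s * W x))) := by
        apply setIntegral_congr_fun measurableSet_Ioi
        intro s hs
        have hs0 : (0 : ℝ) < s := hs
        simp only
        rw [norm_mul]
        congr 1
        exact Real.norm_of_nonneg (by positivity)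
      rw [this, integral_const_mul, (gamma_int hc (hW0 x)).2, norm_mul,
        Real.norm_of_nonneg (rpow_nonneg (hW0 x).le _)]
      ring
    simp only
    rw [this]
    exact hi.norm.mul_const _
  constructor
  · rw [IntegrableOn, hvol]; exact hI
  · rw [hvol, integral_prod _ hI, ← integral_const_mul]
    congr 1
    ext x
    simp only
    rw [integral_const_mul, (gamma_int hc (hW0 x)).2]
    ring

lemma bl_full {d : ℕ}
    {W F κ G : EuclideanSpace ℝ (Fin d) → ℝ} (hWc : Continuous W)
    (hFc : Continuous F) (hκc : Continuous κ) (hGc : Continuous G)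
    (hW0 : ∀ x, 0 < W x) (hκ : ∀ x, 0 < κ x) (hG : ∀ x, 0 ≤ G x)
    {b : ℝ} (hb : (d : ℝ) + 1 < b)
    (hW : ∀ x y c, (∀ p ∈ segment ℝ x y, c ≤ κ p) → ∀ l, 0 ≤ l → l ≤ 1 →
      W (l • x + (1 - l) • y) + l * (1 - l) / 2 * c * ‖x - y‖ ^ 2 ≤ l * W x + (1 - l) * W y)
    (hF : ∀ x y c, (∀ p ∈ segment ℝ x y, G p ≤ c) → F x - F y ≤ c * ‖x - y‖)
    (i0 : Integrable fun x => W x ^ (-b)) (i1 : Integrable fun x => F x * W x ^ (-b))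
    (i2 : Integrable fun x => F x ^ 2 * W x ^ (-b))
    (i3 : Integrable fun x => G x ^ 2 / κ x * W x ^ (-(b - 1))) :
    (∫ x, W x ^ (-b)) * (∫ x, F x ^ 2 * W x ^ (-b)) - (∫ x, F x * W x ^ (-b)) ^ 2 ≤
      (∫ x, W x ^ (-b)) * ((b - 1)⁻¹ * ∫ x, G x ^ 2 / κ x * W x ^ (-(b - 1))) := by
  have hd0 : (0 : ℝ) ≤ d := Nat.cast_nonneg d
  have hb0 : 0 < b := by linarith
  have hb1 : 0 < b - 1 := by linarith
  have hFm := hFc.measurable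
  have hGm := hGc.measurable
  have hκm := hκc.measurable
  have hWm := hWc.measurable
  obtain ⟨j0, k0⟩ := lift_int hWc hW0 (f := fun _ => 1) measurable_const hb0 (by simpa using i0)
  obtain ⟨j1, k1⟩ := lift_int hWc hW0 (f := F) hFm hb0 i1
  obtain ⟨j2, k2⟩ := lift_int hWc hW0 (f := fun x => F x ^ 2) (by fun_prop) hb0 i2
  obtain ⟨j3, k3⟩ := lift_int hWc hW0 (f := fun x => G x ^ 2 / κ x) (by fun_prop) hb1 i3
  simp only [one_mul] at k0
  set D : ℕ → Set (EuclideanSpace ℝ (Fin d) × ℝ) := fun n =>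
    Metric.closedBall 0 n ×ˢ Set.Ioi (1 / ((n : ℝ) + 1)) with hDdef
  have hDm : ∀ n, MeasurableSet (D n) := fun n =>
    measurableSet_closedBall.prod measurableSet_Ioi
  have hDmono : Monotone D := by
    intro n m hnm
    have hnm' : (n : ℝ) ≤ m := by exact_mod_cast hnm
    apply Set.prod_mono
    · exact Metric.closedBall_subset_closedBall hnm'
    · apply Set.Ioi_subset_Ioi
      gcongr
  have hDU : ⋃ n, D n = Set.univ ×ˢ Set.Ioi 0 := by
    ext p
    simp only [Set.mem_iUnion, hDdef, Set.mem_prod, Set.mem_univ, true_and, Set.mem_Ioi,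
      mem_closedBall_zero_iff]
    constructor
    · rintro ⟨n, -, h⟩
      exact lt_trans (by positivity) h
    · intro hp
      obtain ⟨n, hn⟩ := exists_nat_one_div_lt hp
      obtain ⟨m, hm⟩ := exists_nat_ge ‖p.1‖
      refine ⟨max n m, ?_, ?_⟩
      · exact hm.trans (by exact_mod_cast le_max_right n m)
      · refine lt_of_le_of_lt ?_ hn
        have : (n : ℝ) ≤ (max n m : ℕ) := by exact_mod_cast le_max_left n m
        gcongr
  have hDsub : ∀ n, D n ⊆ Set.univ ×ˢ Set.Ioi 0 := fun n => hDU ▸ Set.subset_iUnion D n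
  set ν : ℕ → Measure (EuclideanSpace ℝ (Fin d) × ℝ) := fun n =>
    (volume.withDensity fun p => ENNReal.ofReal (liftDens W b p)).restrict (D n) with hνdef
  have hρm : Measurable fun p : EuclideanSpace ℝ (Fin d) × ℝ =>
      ENNReal.ofReal (liftDens W b p) := by unfold liftDens; fun_prop
  have hνfin : ∀ n, IsFiniteMeasure (ν n) := by
    intro n
    simp only [hνdef]
    rw [restrict_withDensity (hDm n)]
    apply isFiniteMeasure_withDensity_ofReal
    have : IntegrableOn (fun p : EuclideanSpace ℝ (Fin d) × ℝ => liftDens W b p) (D n) := by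
      have := j0.mono_set (hDsub n)
      simp only [one_mul] at this
      exact this
    exact this.2
  have hIntEq : ∀ n (g : EuclideanSpace ℝ (Fin d) × ℝ → ℝ),
      ∫ p, g p ∂(ν n) = ∫ p in D n, g p * liftDens W b p := by
    intro n g
    simp only [hνdef]
    rw [restrict_withDensity (hDm n), integral_withDensity_eq_integral_toReal_smul hρm
      (Filter.Eventually.of_forall fun _ => ENNReal.ofReal_lt_top)]
    apply setIntegral_congr_fun (hDm n)
    intro p hp
    have hp0 : (0 : ℝ) < p.2 := (hDsub n hp).2
    simp only
    rw [ENNReal.toReal_ofReal (by unfold liftDens; positivity), smul_eq_mul, mul_comm]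
  have hlim : ∀ (g h : EuclideanSpace ℝ (Fin d) × ℝ → ℝ) (I : ℝ),
      IntegrableOn h (Set.univ ×ˢ Set.Ioi 0) → (∫ p in Set.univ ×ˢ Set.Ioi 0, h p = I) →
      (∀ p : EuclideanSpace ℝ (Fin d) × ℝ, 0 < p.2 → g p * liftDens W b p = h p) →
      Filter.Tendsto (fun n => ∫ p, g p ∂(ν n)) Filter.atTop (nhds I) := by
    intro g h I hi hI hgh
    simp_rw [hIntEq]
    have e : ∀ n, ∫ p in D n, g p * liftDens W b p = ∫ p in D n, h p := by
      intro n
      apply setIntegral_congr_fun (hDm n)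
      intro p hp
      exact hgh p (hDsub n hp).2
    simp_rw [e]
    have := tendsto_setIntegral_of_monotone hDm hDmono (f := h) (μ := volume) (by rwa [hDU])
    rwa [hDU, hI] at this
  have t0 := hlim (fun _ => 1) _ _ j0 (by simpa only [one_mul] using k0) (fun p _ => rfl)
  have t1 := hlim (fun p => F p.1) _ _ j1 k1 (fun p _ => rfl)
  have t2 := hlim (fun p => F p.1 ^ 2) _ _ j2 k2 (fun p _ => rfl)
  have t3 := hlim (fun p => G p.1 ^ 2 / κ p.1 / p.2) _ _ j3 k3 (fun p hp => by
    unfold liftDens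
    have : p.2 ^ (b - 1) = p.2 ^ (b - 1 - 1) * p.2 := by
      conv_rhs => rw [← rpow_add_one hp.ne']
      congr 1; ring
    rw [this]; field_simp)
  have hineq : ∀ n, (∫ p, (1 : ℝ) ∂(ν n)) * (∫ p, F p.1 ^ 2 ∂(ν n)) - (∫ p, F p.1 ∂(ν n)) ^ 2 ≤
      (∫ p, (1 : ℝ) ∂(ν n)) * ∫ p, G p.1 ^ 2 / κ p.1 / p.2 ∂(ν n) := by
    intro n
    have := hνfin n
    have e : ∫ p, (1 : ℝ) ∂(ν n) = (ν n).real Set.univ := by simp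
    rw [e]
    exact bl_compact (isCompact_closedBall 0 (n : ℝ)) (convex_closedBall 0 (n : ℝ)) hWc hFc hκc
      hGc hκ hG hb (a := 1 / ((n : ℝ) + 1)) (by positivity) hW hF (ν n) rfl
  have hfin := le_of_tendsto_of_tendsto' ((t0.mul t2).sub (t1.pow 2)) (t0.mul t3) hineq
  have hΓ : Gamma b = (b - 1) * Gamma (b - 1) := by
    have := Gamma_add_one hb1.ne'
    rwa [sub_add_cancel] at this
  have hΓ0 : 0 < Gamma (b - 1) := Gamma_pos_of_pos hb1
  rw [hΓ] at hfin
  set Z := ∫ x, W x ^ (-b)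
  set A := ∫ x, F x ^ 2 * W x ^ (-b)
  set B := ∫ x, F x * W x ^ (-b)
  set C := ∫ x, G x ^ 2 / κ x * W x ^ (-(b - 1))
  have hpos : 0 < ((b - 1) * Gamma (b - 1)) ^ 2 := by positivity
  rw [← mul_le_mul_iff_right₀ hpos]
  calc _ = (b - 1) * Gamma (b - 1) * Z * ((b - 1) * Gamma (b - 1) * A) -
        ((b - 1) * Gamma (b - 1) * B) ^ 2 := by ring
    _ ≤ _ := hfin
    _ = _ := by field_simp


lemma line_d1 {E : Type*} [NormedAddCommGroup E] [NormedSpace ℝ E] {W : E → ℝ}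
    (hW : ContDiff ℝ 2 W) (y u : E) (t : ℝ) :
    HasDerivAt (fun t : ℝ => W (y + t • u)) (fderiv ℝ W (y + t • u) u) t := by
  have h1 : HasDerivAt (fun t : ℝ => y + t • u) u t := by
    simpa using ((hasDerivAt_id t).smul_const u).const_add y
  have h2 : HasFDerivAt W (fderiv ℝ W (y + t • u)) (y + t • u) :=
    (hW.differentiable (by norm_num) _).hasFDerivAt
  exact h2.comp_hasDerivAt t h1

lemma line_d2 {E : Type*} [NormedAddCommGroup E] [NormedSpace ℝ E] {W : E → ℝ}
    (hW : ContDiff ℝ 2 W) (y u : E) (t : ℝ) :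
    HasDerivAt (fun t : ℝ => fderiv ℝ W (y + t • u) u)
      (fderiv ℝ (fderiv ℝ W) (y + t • u) u u) t := by
  have h1 : HasDerivAt (fun t : ℝ => y + t • u) u t := by
    simpa using ((hasDerivAt_id t).smul_const u).const_add y
  have hd : ContDiff ℝ 1 (fderiv ℝ W) := hW.fderiv_right (by norm_num)
  have h2 : HasFDerivAt (fderiv ℝ W) (fderiv ℝ (fderiv ℝ W) (y + t • u)) (y + t • u) :=
    (hd.differentiable (by norm_num) _).hasFDerivAt
  have h3 := h2.comp_hasDerivAt t h1
  simpa using h3.clm_apply (hasDerivAt_const t u)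

lemma hess_psd {E : Type*} [NormedAddCommGroup E] [NormedSpace ℝ E] {W : E → ℝ}
    (hW : ContDiff ℝ 2 W) (hc : ConvexOn ℝ Set.univ W) (x u : E) :
    0 ≤ fderiv ℝ (fderiv ℝ W) x u u := by
  have hg : ConvexOn ℝ Set.univ (fun t : ℝ => W (x + t • u)) := by
    refine ⟨convex_univ, ?_⟩
    intro s _ t _ a b ha hb hab
    have := hc.2 (Set.mem_univ (x + s • u)) (Set.mem_univ (x + t • u)) ha hb hab
    have e : a • (x + s • u) + b • (x + t • u) = x + (a • s + b • t) • u := by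
      calc _ = (a + b) • x + (a • s + b • t) • u := by
            simp only [smul_eq_mul]; module
        _ = _ := by rw [hab, one_smul]
    rw [e] at this
    exact this
  have hm := hg.monotoneOn_deriv (fun t _ => (line_d1 hW x u t).differentiableAt)
  have hd : deriv (fun t : ℝ => W (x + t • u)) = fun t => fderiv ℝ W (x + t • u) u :=
    funext fun t => (line_d1 hW x u t).deriv
  rw [hd] at hm
  have := (monotoneOn_univ.1 hm).deriv_nonneg (x := 0)
  rw [(line_d2 hW x u 0).deriv] at this
  simpa using this

lemma strong_conv {E : Type*} [NormedAddCommGroup E] [NormedSpace ℝ E] {W κ : E → ℝ}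
    (hW : ContDiff ℝ 2 W)
    (hH : ∀ x u, κ x * ‖u‖ ^ 2 ≤ fderiv ℝ (fderiv ℝ W) x u u)
    (x y : E) (c : ℝ) (hc : ∀ p ∈ segment ℝ x y, c ≤ κ p) (l : ℝ) (hl0 : 0 ≤ l) (hl1 : l ≤ 1) :
    W (l • x + (1 - l) • y) + l * (1 - l) / 2 * c * ‖x - y‖ ^ 2 ≤ l * W x + (1 - l) * W y := by
  set u := x - y with hu
  have hg : ConvexOn ℝ (Set.Icc 0 1)
      (fun t : ℝ => W (y + t • u) - c * ‖u‖ ^ 2 / 2 * t ^ 2) := by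
    apply convexOn_of_hasDerivWithinAt2_nonneg (convex_Icc 0 1)
      (f' := fun t => fderiv ℝ W (y + t • u) u - c * ‖u‖ ^ 2 * t)
      (f'' := fun t => fderiv ℝ (fderiv ℝ W) (y + t • u) u u - c * ‖u‖ ^ 2)
    · have := hW.continuous
      fun_prop
    · intro t _
      apply HasDerivAt.hasDerivWithinAt
      have := (line_d1 hW y u t).sub ((hasDerivAt_pow 2 t).const_mul (c * ‖u‖ ^ 2 / 2))
      refine this.congr_deriv ?_
      push_cast
      ring
    · intro t _
      apply HasDerivAt.hasDerivWithinAt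
      have := (line_d2 hW y u t).sub ((hasDerivAt_id t).const_mul (c * ‖u‖ ^ 2))
      refine this.congr_deriv ?_
      ring
    · intro t ht
      rw [interior_Icc] at ht
      have hmem : y + t • u ∈ segment ℝ x y := by
        refine ⟨t, 1 - t, ht.1.le, by linarith [ht.2], by ring, ?_⟩
        rw [hu]; module
      have h1 := hc _ hmem
      have h2 := hH (y + t • u) u
      have h3 := mul_le_mul_of_nonneg_right h1 (sq_nonneg ‖u‖)
      linarith
  have := hg.2 (x := 1) (y := 0) (by simp) (by simp) hl0 (by linarith : 0 ≤ 1 - l) (by ring)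
  simp only [smul_eq_mul, mul_one, mul_zero, add_zero, one_smul, zero_smul] at this
  have e1 : y + l • u = l • x + (1 - l) • y := by rw [hu]; module
  have e2 : y + u = x := by rw [hu]; abel
  rw [e1, e2] at this
  nlinarith [this]

lemma hess_inner {d : ℕ} (W : EuclideanSpace ℝ (Fin d) → ℝ) (x u w : EuclideanSpace ℝ (Fin d)) :
    fderiv ℝ (fderiv ℝ W) x u w =
      inner ℝ u (Matrix.toEuclideanLin (hessianMatrix W x) w) := by
  have hexp : ∀ u : EuclideanSpace ℝ (Fin d),
      u = ∑ i, u i • EuclideanSpace.single i (1 : ℝ) := by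
    intro u
    ext j
    simp [Pi.single_apply]
  conv_lhs => rw [hexp u, hexp w]
  rw [Matrix.toLpLin_apply, EuclideanSpace.inner_eq_star_dotProduct]
  simp only [map_sum, map_smul, _root_.sum_apply, _root_.smul_apply,
    smul_eq_mul, dotProduct, mulVec, hessianMatrix, Matrix.of_apply, iteratedFDeriv_two_apply,
    Matrix.cons_val_zero, Matrix.cons_val_one, star_trivial]
  simp only [Finset.mul_sum, Finset.sum_mul]
  rw [Finset.sum_comm]
  apply Finset.sum_congr rfl
  intro i _
  apply Finset.sum_congr rfl
  intro j _
  ring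

lemma hess_lower {d : ℕ} {W : EuclideanSpace ℝ (Fin d) → ℝ}
    (hW : ContDiff ℝ 2 W) (hc : ConvexOn ℝ Set.univ W) (x : EuclideanSpace ℝ (Fin d))
    (hinv : IsUnit (hessianMatrix W x)) {a C : ℝ} (ha : 0 < a) (hC : 0 < C)
    (hb : ∀ v : EuclideanSpace ℝ (Fin d),
      ‖Matrix.toEuclideanLin (a • (hessianMatrix W x)⁻¹) v‖ ≤ C * ‖v‖)
    (v : EuclideanSpace ℝ (Fin d)) :
    a / C * ‖v‖ ^ 2 ≤ fderiv ℝ (fderiv ℝ W) x v v := by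
  set H := hessianMatrix W x with hH
  set w := Matrix.toEuclideanLin H⁻¹ v with hw
  have hHw : Matrix.toEuclideanLin H w = v := by
    rw [hw, Matrix.toLpLin_apply, Matrix.toLpLin_apply]
    simp only [Matrix.mulVec_mulVec]
    rw [Matrix.mul_nonsing_inv _ ((Matrix.isUnit_iff_isUnit_det _).1 hinv)]
    simp
  have hB : ∀ u, fderiv ℝ (fderiv ℝ W) x u w = inner ℝ u v := by
    intro u
    rw [hess_inner, ← hH, hHw]
  have hsymm : fderiv ℝ (fderiv ℝ W) x w v = fderiv ℝ (fderiv ℝ W) x v w :=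
    (hW.contDiffAt.isSymmSndFDerivAt (by simp) : IsSymmSndFDerivAt ℝ W x) w v
  set k := a / C with hk
  have hk0 : 0 < k := by positivity
  have hwn : k * ‖w‖ ≤ ‖v‖ := by
    have := hb v
    rw [map_smul, LinearMap.smul_apply, ← hw, norm_smul, Real.norm_of_nonneg ha.le] at this
    rw [hk, div_mul_eq_mul_div, div_le_iff₀ hC]
    linarith
  have hp := hess_psd hW hc x (v - k • w)
  simp only [map_sub, map_smul, _root_.sub_apply, _root_.smul_apply,
    smul_eq_mul, hsymm] at hp
  rw [hB, hB, real_inner_self_eq_norm_sq] at hp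
  have h1 : inner ℝ w v ≤ ‖w‖ * ‖v‖ := real_inner_le_norm w v
  have h2 : k * (k * inner ℝ w v) ≤ k * ‖v‖ ^ 2 := by
    apply mul_le_mul_of_nonneg_left _ hk0.le
    calc k * inner ℝ w v ≤ k * (‖w‖ * ‖v‖) := mul_le_mul_of_nonneg_left h1 hk0.le
      _ = (k * ‖w‖) * ‖v‖ := by ring
      _ ≤ ‖v‖ * ‖v‖ := mul_le_mul_of_nonneg_right hwn (norm_nonneg _)
      _ = _ := by ring
  linarith

lemma norm_grad {d : ℕ} (φ : EuclideanSpace ℝ (Fin d) → ℝ) (x : EuclideanSpace ℝ (Fin d)) :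
    ‖gradient φ x‖ = ‖fderiv ℝ φ x‖ := by
  unfold gradient
  exact LinearIsometryEquiv.norm_map _ _

/-- Weighted Poincaré inequality for small `β`: if for some `γ ∈ (0, β/(d+2))` the
function `V^γ` is convex with invertible Hessian and
`sup_x ‖V(x)^{γ-1} (∇²(V^γ))⁻¹(x)‖₂ ≤ C_V(γ)`, then
`Var_{π_β}(φ) ≤ C_V(γ) (β/γ − 1)⁻¹ ∫ |∇φ|² V dπ_β`. -/
theorem weighted_poincare_small_beta
    (d : ℕ) (hd : 1 ≤ d) (β : ℝ) (hβ : 0 < β)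
    (V : EuclideanSpace ℝ (Fin d) → ℝ)
    (hV : ContDiff ℝ 2 V) (hVpos : ∀ x, 0 < V x)
    (Zβ : ℝ) (hZβ : Zβ = ∫ x, V x ^ (-β))
    (hZint : Integrable fun x : EuclideanSpace ℝ (Fin d) => V x ^ (-β))
    (πβ : EuclideanSpace ℝ (Fin d) → ℝ)
    (hπβ : ∀ x, πβ x = Zβ⁻¹ * V x ^ (-β))
    (γ : ℝ) (hγ0 : 0 < γ) (hγβ : γ < β / (d + 2))
    (hVγconv : ConvexOn ℝ Set.univ fun x => V x ^ γ)
    (hVγinv : ∀ x, IsUnit (hessianMatrix (fun y => V y ^ γ) x))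
    (CVγ : ℝ) (hCVγ0 : 0 < CVγ)
    (hCVγ : ∀ x (v : EuclideanSpace ℝ (Fin d)),
      ‖Matrix.toEuclideanLin
          (V x ^ (γ - 1) • (hessianMatrix (fun y => V y ^ γ) x)⁻¹) v‖ ≤ CVγ * ‖v‖)
    (φ : EuclideanSpace ℝ (Fin d) → ℝ) (hφ : ContDiff ℝ (⊤ : ℕ∞) φ)
    (hφ2 : Integrable fun x => φ x ^ 2 * πβ x)
    (hφ1 : Integrable fun x => φ x * πβ x)
    (hRHS : Integrable fun x => ‖gradient φ x‖ ^ 2 * V x * πβ x) :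
    (∫ x, φ x ^ 2 * πβ x) - (∫ x, φ x * πβ x) ^ 2 ≤
      CVγ * (β / γ - 1)⁻¹ * ∫ x, ‖gradient φ x‖ ^ 2 * V x * πβ x := by
  have hd0 : (0 : ℝ) ≤ d := Nat.cast_nonneg d
  have hVc := hV.continuous
  have hφc := hφ.continuous
  have hWC : ContDiff ℝ 2 fun x => V x ^ γ := hV.rpow_const_of_ne fun x => (hVpos x).ne'
  have hfc : Continuous fun x => ‖fderiv ℝ φ x‖ := (hφ.continuous_fderiv (by simp)).norm
  have hGc : Continuous fun x => ‖gradient φ x‖ := by simp_rw [norm_grad]; exact hfc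
  have hκc : Continuous fun x => V x ^ (γ - 1) / CVγ :=
    (hVc.rpow_const fun x => Or.inl (hVpos x).ne').div_const _
  have hκ : ∀ x, 0 < V x ^ (γ - 1) / CVγ := fun x => div_pos (rpow_pos_of_pos (hVpos x) _) hCVγ0
  have hb : (d : ℝ) + 1 < β / γ := by
    rw [lt_div_iff₀ (by positivity)] at hγβ
    rw [lt_div_iff₀ hγ0]
    nlinarith
  have hb1 : 0 < β / γ - 1 := by linarith
  have hZ : 0 < Zβ := by
    rw [hZβ]
    rw [integral_pos_iff_support_of_nonneg (fun x => (rpow_pos_of_pos (hVpos x) _).le) hZint]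
    have : Function.support (fun x => V x ^ (-β)) = Set.univ := by
      ext x
      simpa using (rpow_pos_of_pos (hVpos x) (-β)).ne'
    rw [this]
    exact Measure.measure_univ_pos.2 (NeZero.ne _)
  have eW : ∀ x, (V x ^ γ) ^ (-(β / γ)) = V x ^ (-β) := by
    intro x
    rw [← rpow_mul (hVpos x).le]
    congr 1
    field_simp
  have eπ : ∀ x, V x ^ (-β) = Zβ * πβ x := by
    intro x
    rw [hπβ]
    field_simp
  have e3 : ∀ x, ‖gradient φ x‖ ^ 2 / (V x ^ (γ - 1) / CVγ) * (V x ^ γ) ^ (-(β / γ - 1)) =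
      CVγ * Zβ * (‖gradient φ x‖ ^ 2 * V x * πβ x) := by
    intro x
    have h1 : (V x ^ γ) ^ (-(β / γ - 1)) = V x ^ (-β) * (V x ^ (γ - 1) * V x) := by
      rw [← rpow_mul (hVpos x).le, ← rpow_add_one (hVpos x).ne', ← rpow_add (hVpos x)]
      congr 1
      field_simp
      ring
    rw [h1, eπ]
    have := (rpow_pos_of_pos (hVpos x) (γ - 1)).ne'
    field_simp
  have e1 : ∀ x, φ x * (V x ^ γ) ^ (-(β / γ)) = Zβ * (φ x * πβ x) := by
    intro x; rw [eW, eπ]; ring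
  have e2 : ∀ x, φ x ^ 2 * (V x ^ γ) ^ (-(β / γ)) = Zβ * (φ x ^ 2 * πβ x) := by
    intro x; rw [eW, eπ]; ring
  have key := bl_full (W := fun x => V x ^ γ) (F := φ) (κ := fun x => V x ^ (γ - 1) / CVγ)
    (G := fun x => ‖gradient φ x‖) hWC.continuous hφc hκc hGc
    (fun x => rpow_pos_of_pos (hVpos x) _) hκ (fun x => norm_nonneg _) hb
    (strong_conv hWC fun x u => hess_lower hWC hVγconv x (hVγinv x)
      (rpow_pos_of_pos (hVpos x) _) hCVγ0 (hCVγ x) u)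
    (by
      intro x y c hc
      have := (convex_segment x y).norm_image_sub_le_of_norm_hasFDerivWithin_le (𝕜 := ℝ)
        (f := φ) (f' := fderiv ℝ φ) (C := c) (x := y) (y := x)
        (fun p _ => ((hφ.differentiable (by simp)) p).hasFDerivAt.hasFDerivWithinAt)
        (fun p hp => by rw [← norm_grad]; exact hc p hp)
        (right_mem_segment ℝ x y) (left_mem_segment ℝ x y)
      exact (le_abs_self _).trans this)
    (by simp only [eW]; exact hZint)
    (by simp only [e1]; exact hφ1.const_mul _)
    (by simp only [e2]; exact hφ2.const_mul _)
    (by simp only [e3]; exact hRHS.const_mul _)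
  simp only [e1, e2, e3] at key
  simp only [eW, integral_const_mul] at key
  rw [← hZβ] at key
  have hpos : 0 < Zβ ^ 2 := by positivity
  rw [← mul_le_mul_iff_right₀ hpos]
  calc _ = _ := by ring
    _ ≤ _ := key
    _ = _ := by ring
end

section
/- Let d ≥ 1 be an integer, β > d/2 + 1, and let V ∈ C²(ℝ^d) be positive, α-strongly convex (∇²V ⪰ α I_d, α > 0), L-gradient Lipschitz (∇²V ⪯ L I_d), and attain its global minimum at 0. Write Z_s := ∫_{ℝ^d} V(x)^{-s} dx for s > d/2. Then for every r ∈ (0, β − d/2 − 1): Z_{β−1}/Z_β ≤ (L/α)^{(d/2)/(β−d/2−r)} · V(0) · (Γ(β)Γ(r) / (Γ(d/2+r)Γ(β−d/2)))^{1/(β−d/2−r)}. -/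
open MeasureTheory Real Matrix

lemma gamma_lint {a c : ℝ} (ha : 0 < a) (hc : 0 < c) :
    ∫⁻ t in Set.Ioi (0:ℝ), ENNReal.ofReal (t ^ (a - 1) * rexp (-(c * t)))
      = ENNReal.ofReal (c ^ (-a) * Real.Gamma a) := by
  have h := Real.integral_rpow_mul_exp_neg_mul_Ioi ha hc
  have hG := Real.Gamma_pos_of_pos ha
  have e : (1 / c) ^ a = c ^ (-a) := by
    rw [one_div, Real.inv_rpow hc.le, Real.rpow_neg hc.le]
  rw [e] at h
  rw [← ofReal_integral_eq_lintegral_ofReal, h]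
  · apply Integrable.of_integral_ne_zero
    rw [h]
    positivity
  · filter_upwards [ae_restrict_mem measurableSet_Ioi] with t ht
    have : 0 < t := ht
    simp only [Pi.zero_apply]
    positivity

lemma gauss_lint (d : ℕ) {b : ℝ} (hb : 0 < b) :
    ∫⁻ x : EuclideanSpace ℝ (Fin d), ENNReal.ofReal (rexp (-b * ‖x‖ ^ 2))
      = ENNReal.ofReal ((π / b) ^ ((d : ℝ) / 2)) := by
  have h := GaussianFourier.integral_rexp_neg_mul_sq_norm
    (V := EuclideanSpace ℝ (Fin d)) hb
  rw [finrank_euclideanSpace_fin] at h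
  rw [← ofReal_integral_eq_lintegral_ofReal, h]
  · apply Integrable.of_integral_ne_zero
    rw [h]
    positivity
  · exact Filter.Eventually.of_forall fun x => (Real.exp_pos _).le

lemma student_lint (d : ℕ) {a b s : ℝ} (ha : 0 < a) (hb : 0 < b) (hs : (d : ℝ) / 2 < s) :
    ∫⁻ x : EuclideanSpace ℝ (Fin d), ENNReal.ofReal ((a + b * ‖x‖ ^ 2) ^ (-s))
      = ENNReal.ofReal (a ^ (-(s - (d:ℝ)/2)) * (π / b) ^ ((d : ℝ) / 2) *
          Real.Gamma (s - (d:ℝ)/2) / Real.Gamma s) := by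
  have hs0 : 0 < s := lt_of_le_of_lt (by positivity) hs
  have hG := Real.Gamma_pos_of_pos hs0
  have hG' := Real.Gamma_pos_of_pos (sub_pos.2 hs)
  have key : ∫⁻ x : EuclideanSpace ℝ (Fin d),
      ENNReal.ofReal ((a + b * ‖x‖ ^ 2) ^ (-s) * Real.Gamma s)
      = ENNReal.ofReal ((π / b) ^ ((d : ℝ) / 2)) *
        ENNReal.ofReal (a ^ (-(s - (d:ℝ)/2)) * Real.Gamma (s - (d:ℝ)/2)) := by
    have h1 : ∀ x : EuclideanSpace ℝ (Fin d),
        ENNReal.ofReal ((a + b * ‖x‖ ^ 2) ^ (-s) * Real.Gamma s) =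
        ∫⁻ t in Set.Ioi (0:ℝ),
          ENNReal.ofReal (t ^ (s - 1) * rexp (-((a + b * ‖x‖ ^ 2) * t))) := fun x =>
      (gamma_lint hs0 (by positivity)).symm
    simp_rw [h1]
    rw [lintegral_lintegral_swap]
    · rw [← gamma_lint (sub_pos.2 hs) ha, ← lintegral_const_mul' _ _ ENNReal.ofReal_ne_top]
      apply setLIntegral_congr_fun measurableSet_Ioi
      intro t ht
      have ht : 0 < t := ht
      have h2 : ∀ x : EuclideanSpace ℝ (Fin d),
          ENNReal.ofReal (t ^ (s - 1) * rexp (-((a + b * ‖x‖ ^ 2) * t)))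
          = ENNReal.ofReal (t ^ (s - 1) * rexp (-(a * t))) *
            ENNReal.ofReal (rexp (-(b * t) * ‖x‖ ^ 2)) := by
        intro x
        rw [← ENNReal.ofReal_mul (by positivity), mul_assoc, ← Real.exp_add]
        congr 3
        ring
      simp only [h2]
      rw [lintegral_const_mul' _ _ ENNReal.ofReal_ne_top, gauss_lint d (by positivity),
        ← ENNReal.ofReal_mul (by positivity), ← ENNReal.ofReal_mul (by positivity)]
      congr 1
      rw [← div_div, Real.div_rpow (by positivity) ht.le,
        show s - (d:ℝ)/2 - 1 = (s - 1) - (d:ℝ)/2 by ring, Real.rpow_sub ht (s - 1)]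
      ring
    · apply Measurable.aemeasurable
      apply Measurable.ennreal_ofReal
      fun_prop
  have h3 : ∀ x : EuclideanSpace ℝ (Fin d),
      ENNReal.ofReal ((a + b * ‖x‖ ^ 2) ^ (-s)) =
        ENNReal.ofReal ((a + b * ‖x‖ ^ 2) ^ (-s) * Real.Gamma s)
          * ENNReal.ofReal (Real.Gamma s)⁻¹ := by
    intro x
    rw [← ENNReal.ofReal_mul (by positivity), mul_assoc, mul_inv_cancel₀ hG.ne', mul_one]
  simp_rw [h3]
  rw [lintegral_mul_const' _ _ ENNReal.ofReal_ne_top, key, ← ENNReal.ofReal_mul (by positivity),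
    ← ENNReal.ofReal_mul (by positivity)]
  congr 1
  ring

lemma student_int (d : ℕ) {a b s : ℝ} (ha : 0 < a) (hb : 0 < b) (hs : (d : ℝ) / 2 < s) :
    Integrable (fun x : EuclideanSpace ℝ (Fin d) => (a + b * ‖x‖ ^ 2) ^ (-s)) ∧
    ∫ x : EuclideanSpace ℝ (Fin d), (a + b * ‖x‖ ^ 2) ^ (-s)
      = a ^ (-(s - (d:ℝ)/2)) * (π / b) ^ ((d : ℝ) / 2) *
          Real.Gamma (s - (d:ℝ)/2) / Real.Gamma s := by
  have hs0 : 0 < s := lt_of_le_of_lt (by positivity) hs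
  have hG := Real.Gamma_pos_of_pos hs0
  have hG' := Real.Gamma_pos_of_pos (sub_pos.2 hs)
  have hv : ∫ x : EuclideanSpace ℝ (Fin d), (a + b * ‖x‖ ^ 2) ^ (-s)
      = a ^ (-(s - (d:ℝ)/2)) * (π / b) ^ ((d : ℝ) / 2) *
          Real.Gamma (s - (d:ℝ)/2) / Real.Gamma s := by
    rw [integral_eq_lintegral_of_nonneg_ae, student_lint d ha hb hs, ENNReal.toReal_ofReal]
    · positivity
    · exact Filter.Eventually.of_forall fun x => by
        simp only [Pi.zero_apply]; positivity
    · apply Measurable.aestronglyMeasurable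
      fun_prop
  refine ⟨?_, hv⟩
  apply Integrable.of_integral_ne_zero
  rw [hv]
  positivity

lemma second_order {f f' f'' : ℝ → ℝ} (h1 : ∀ t, HasDerivAt f (f' t) t)
    (h2 : ∀ t, HasDerivAt f' (f'' t) t) (h3 : ∀ t, 0 ≤ f'' t) (h0 : f' 0 = 0) :
    f 0 ≤ f 1 := by
  have m1 : Monotone f' := monotone_of_deriv_nonneg (fun t => (h2 t).differentiableAt)
    (fun t => by rw [(h2 t).deriv]; exact h3 t)
  have m2 : MonotoneOn f (Set.Ici 0) := by
    apply monotoneOn_of_deriv_nonneg (convex_Ici 0)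
    · exact fun t _ => (h1 t).continuousAt.continuousWithinAt
    · exact fun t _ => (h1 t).differentiableAt.differentiableWithinAt
    · intro t ht
      rw [interior_Ici] at ht
      rw [(h1 t).deriv, ← h0]
      exact m1 (le_of_lt ht)
  exact m2 (by simp) (by simp) zero_le_one

lemma hess_quad {d : ℕ} (V : EuclideanSpace ℝ (Fin d) → ℝ) (y x : EuclideanSpace ℝ (Fin d)) :
    x.ofLp ⬝ᵥ (hessianMatrix V y *ᵥ x.ofLp) = fderiv ℝ (fderiv ℝ V) y x x := by
  have hx : x = ∑ i, x i • EuclideanSpace.single i (1:ℝ) := by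
    ext j
    simp [Finset.sum_apply, Pi.single_apply]
  conv_rhs => rw [hx]
  simp only [map_sum, _root_.sum_apply, map_smul, _root_.smul_apply,
    dotProduct, mulVec, hessianMatrix, Matrix.of_apply, iteratedFDeriv_two_apply,
    Finset.mul_sum, smul_eq_mul]
  rw [Finset.sum_comm]
  apply Finset.sum_congr rfl; intro i _
  apply Finset.sum_congr rfl; intro j _
  simp
  ring

lemma quad_bounds {d : ℕ} (V : EuclideanSpace ℝ (Fin d) → ℝ)
    (hV : ContDiff ℝ 2 V) (α L : ℝ)
    (hstrong : ∀ x, (hessianMatrix V x - α • 1).PosSemidef)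
    (hlip : ∀ x, ((L • 1 : Matrix (Fin d) (Fin d) ℝ) - hessianMatrix V x).PosSemidef)
    (hmin : ∀ x, V 0 ≤ V x) (x : EuclideanSpace ℝ (Fin d)) :
    V 0 + α / 2 * ‖x‖ ^ 2 ≤ V x ∧ V x ≤ V 0 + L / 2 * ‖x‖ ^ 2 := by
  have hn : x.ofLp ⬝ᵥ x.ofLp = ‖x‖ ^ 2 := by
    rw [EuclideanSpace.real_norm_sq_eq]
    simp [dotProduct, sq]
  have l1 : ∀ y, α * ‖x‖ ^ 2 ≤ fderiv ℝ (fderiv ℝ V) y x x := by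
    intro y
    have := (hstrong y).dotProduct_mulVec_nonneg x.ofLp
    simp only [sub_mulVec, dotProduct_sub, star_trivial, hess_quad, smul_mulVec, one_mulVec,
      dotProduct_smul, hn, smul_eq_mul] at this
    linarith
  have l2 : ∀ y, fderiv ℝ (fderiv ℝ V) y x x ≤ L * ‖x‖ ^ 2 := by
    intro y
    have := (hlip y).dotProduct_mulVec_nonneg x.ofLp
    simp only [sub_mulVec, dotProduct_sub, star_trivial, hess_quad, smul_mulVec, one_mulVec,
      dotProduct_smul, hn, smul_eq_mul] at this
    linarith
  have hl : ∀ t : ℝ, HasDerivAt (fun t : ℝ => t • x) x t := fun t => by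
    simpa using (hasDerivAt_id t).smul_const x
  have hd1 : ∀ t : ℝ, HasDerivAt (fun t : ℝ => V (t • x)) (fderiv ℝ V (t • x) x) t := fun t =>
    ((hV.differentiable (by norm_num) (t • x)).hasFDerivAt).comp_hasDerivAt t (hl t)
  have hV1 : ContDiff ℝ 1 (fderiv ℝ V) := hV.fderiv_right (by norm_num)
  have hd2 : ∀ t : ℝ, HasDerivAt (fun t : ℝ => fderiv ℝ V (t • x) x)
      (fderiv ℝ (fderiv ℝ V) (t • x) x x) t := fun t => by
    have := ((hV1.differentiable (by norm_num) (t • x)).hasFDerivAt).comp_hasDerivAt t (hl t)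
    simpa using this.clm_apply (hasDerivAt_const t x)
  have h0 : fderiv ℝ V 0 = 0 :=
    IsLocalMin.fderiv_eq_zero (Filter.Eventually.of_forall hmin)
  have q1 : ∀ c t : ℝ, HasDerivAt (fun t : ℝ => c / 2 * ‖x‖ ^ 2 * t ^ 2) (c * ‖x‖ ^ 2 * t) t := by
    intro c t
    have h := (hasDerivAt_pow 2 t).const_mul (c / 2 * ‖x‖ ^ 2)
    have e : c / 2 * ‖x‖ ^ 2 * (((2:ℕ):ℝ) * t ^ (2 - 1)) = c * ‖x‖ ^ 2 * t := by
      norm_num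
      ring
    rw [e] at h
    exact h
  have q2 : ∀ c t : ℝ, HasDerivAt (fun t : ℝ => c * ‖x‖ ^ 2 * t) (c * ‖x‖ ^ 2) t := by
    intro c t
    simpa using (hasDerivAt_id t).const_mul (c * ‖x‖ ^ 2)
  constructor
  · have := second_order (fun t => (hd1 t).sub (q1 α t)) (fun t => (hd2 t).sub (q2 α t))
      (fun t => by linarith [l1 (t • x)]) (by simp [h0])
    simp at this
    linarith
  · have := second_order (fun t => (q1 L t).sub (hd1 t)) (fun t => (q2 L t).sub (hd2 t))
      (fun t => by linarith [l2 (t • x)]) (by simp [h0])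
    simp at this
    linarith

lemma lyapunov {X : Type*} [MeasurableSpace X] {μ : Measure X} (V : X → ℝ) (hV : ∀ x, 0 < V x)
    {β s : ℝ} (hs : s < β - 1) (iβ : Integrable (fun x => V x ^ (-β)) μ)
    (i1 : Integrable (fun x => V x ^ (-(β - 1))) μ)
    (is : Integrable (fun x => V x ^ (-s)) μ)
    (pβ : 0 < ∫ x, V x ^ (-β) ∂μ) (ps : 0 < ∫ x, V x ^ (-s) ∂μ) :
    (∫ x, V x ^ (-(β - 1)) ∂μ) / (∫ x, V x ^ (-β) ∂μ) ≤
      ((∫ x, V x ^ (-s) ∂μ) / (∫ x, V x ^ (-β) ∂μ)) ^ (1 / (β - s)) := by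
  set A := ∫ x, V x ^ (-β) ∂μ
  set B := ∫ x, V x ^ (-s) ∂μ
  set w := 1 / (β - s) with hw
  have hbs : 0 < β - s := by linarith
  have hw0 : 0 < w := by positivity
  have hw1 : w ≤ 1 := by rw [hw, div_le_one hbs]; linarith
  have hws : w * (β - s) = 1 := by rw [hw]; field_simp
  have pt : ∀ x, V x ^ (-(β - 1)) ≤
      A ^ (1 - w) * B ^ w * ((1 - w) * (V x ^ (-β) / A) + w * (V x ^ (-s) / B)) := by
    intro x
    have hx := hV x
    have := Real.geom_mean_le_arith_mean2_weighted (sub_nonneg.2 hw1) hw0.le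
      (p₁ := V x ^ (-β) / A) (p₂ := V x ^ (-s) / B) (by positivity) (by positivity) (by ring)
    refine le_trans (le_of_eq ?_) (mul_le_mul_of_nonneg_left this (by positivity))
    rw [Real.div_rpow (by positivity) pβ.le, Real.div_rpow (by positivity) ps.le,
      ← Real.rpow_mul hx.le, ← Real.rpow_mul hx.le]
    have e : V x ^ (-(β - 1)) = V x ^ (-β * (1 - w)) * V x ^ (-s * w) := by
      rw [← Real.rpow_add hx]
      congr 1
      linarith
    rw [e]
    have := (Real.rpow_pos_of_pos pβ (1 - w)).ne'
    have := (Real.rpow_pos_of_pos ps w).ne'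
    field_simp
  have I : ∫ x, V x ^ (-(β - 1)) ∂μ ≤ A ^ (1 - w) * B ^ w := by
    refine (integral_mono i1 ((((iβ.div_const A).const_mul (1 - w)).add
      ((is.div_const B).const_mul w)).const_mul (A ^ (1 - w) * B ^ w)) pt).trans (le_of_eq ?_)
    simp only [Pi.add_apply]
    rw [integral_const_mul, integral_add ((iβ.div_const A).const_mul (1 - w))
      ((is.div_const B).const_mul w), integral_const_mul, integral_const_mul,
      integral_div, integral_div, div_self pβ.ne', div_self ps.ne']
    ring
  rw [div_le_iff₀ pβ, Real.div_rpow ps.le pβ.le]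
  refine I.trans (le_of_eq ?_)
  rw [Real.rpow_sub pβ, Real.rpow_one]
  ring

theorem normalization_ratio_bound
    (d : ℕ) (hd : 1 ≤ d) (β : ℝ) (hβ : (d : ℝ) / 2 + 1 < β)
    (V : EuclideanSpace ℝ (Fin d) → ℝ)
    (hV : ContDiff ℝ 2 V) (hVpos : ∀ x, 0 < V x)
    (α L : ℝ) (hα : 0 < α) (hL : 0 < L)
    (hstrong : ∀ x, (hessianMatrix V x - α • 1).PosSemidef)
    (hlip : ∀ x, ((L • 1 : Matrix (Fin d) (Fin d) ℝ) - hessianMatrix V x).PosSemidef)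
    (hmin : ∀ x, V 0 ≤ V x)
    (Zβ Zβ1 : ℝ) (hZβ : Zβ = ∫ x, V x ^ (-β)) (hZβ1 : Zβ1 = ∫ x, V x ^ (-(β - 1)))
    (r : ℝ) (hr0 : 0 < r) (hr1 : r < β - (d : ℝ) / 2 - 1) :
    Zβ1 / Zβ ≤ (L / α) ^ (((d : ℝ) / 2) / (β - (d : ℝ) / 2 - r)) * V 0 *
      ((Real.Gamma β * Real.Gamma r) /
        (Real.Gamma ((d : ℝ) / 2 + r) * Real.Gamma (β - (d : ℝ) / 2)))
          ^ (1 / (β - (d : ℝ) / 2 - r)) := by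
  have hb := quad_bounds V hV α L hstrong hlip hmin
  have h0 := hVpos 0
  have hd0 : (0:ℝ) ≤ (d:ℝ) / 2 := by positivity
  have hi : ∀ s : ℝ, (d:ℝ) / 2 < s → Integrable (fun x => V x ^ (-s)) := by
    intro s hs
    refine (student_int d h0 (half_pos hα) hs).1.mono' ?_ (Filter.Eventually.of_forall ?_)
    · exact (hV.continuous.measurable.pow_const (-s)).aestronglyMeasurable
    · intro x
      have := hVpos x
      rw [Real.norm_of_nonneg (by positivity)]
      exact Real.rpow_le_rpow_of_nonpos (by positivity) (hb x).1 (by linarith)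
  have hup : ∀ s : ℝ, (d:ℝ) / 2 < s → ∫ x, V x ^ (-s) ≤ V 0 ^ (-(s - (d:ℝ)/2)) *
      (π / (α / 2)) ^ ((d : ℝ) / 2) * Real.Gamma (s - (d:ℝ)/2) / Real.Gamma s := by
    intro s hs
    rw [← (student_int d h0 (half_pos hα) hs).2]
    refine integral_mono (hi s hs) (student_int d h0 (half_pos hα) hs).1 fun x => ?_
    exact Real.rpow_le_rpow_of_nonpos (by positivity) (hb x).1 (by linarith)
  have hlo : ∀ s : ℝ, (d:ℝ) / 2 < s → V 0 ^ (-(s - (d:ℝ)/2)) *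
      (π / (L / 2)) ^ ((d : ℝ) / 2) * Real.Gamma (s - (d:ℝ)/2) / Real.Gamma s
        ≤ ∫ x, V x ^ (-s) := by
    intro s hs
    rw [← (student_int d h0 (half_pos hL) hs).2]
    refine integral_mono (student_int d h0 (half_pos hL) hs).1 (hi s hs) fun x => ?_
    exact Real.rpow_le_rpow_of_nonpos (hVpos x) (hb x).2 (by linarith)
  have hlp : ∀ s : ℝ, (d:ℝ) / 2 < s → 0 < V 0 ^ (-(s - (d:ℝ)/2)) *
      (π / (L / 2)) ^ ((d : ℝ) / 2) * Real.Gamma (s - (d:ℝ)/2) / Real.Gamma s := by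
    intro s hs
    have := Real.Gamma_pos_of_pos (sub_pos.2 hs)
    have := Real.Gamma_pos_of_pos (lt_of_le_of_lt hd0 hs)
    positivity
  have hsβ : (d:ℝ) / 2 < β := by linarith
  have hss : (d:ℝ) / 2 < (d:ℝ) / 2 + r := by linarith
  have pβ := (hlp β hsβ).trans_le (hlo β hsβ)
  have ps := (hlp _ hss).trans_le (hlo _ hss)
  have main := lyapunov (μ := volume) V hVpos (β := β) (s := (d:ℝ) / 2 + r) (by linarith)
    (hi _ hsβ) (hi _ (by linarith)) (hi _ hss) pβ ps
  rw [← hZβ, ← hZβ1] at main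
  rw [← hZβ] at pβ
  have hlo' := hlo β hsβ
  rw [← hZβ] at hlo'
  have hE : 0 < β - (d:ℝ) / 2 - r := by linarith
  rw [show β - ((d:ℝ) / 2 + r) = β - (d:ℝ) / 2 - r by ring] at main
  refine main.trans ?_
  have g1 := Real.Gamma_pos_of_pos hr0
  have g2 := Real.Gamma_pos_of_pos (lt_of_le_of_lt hd0 hss)
  have g3 := Real.Gamma_pos_of_pos (sub_pos.2 hsβ)
  have g4 := Real.Gamma_pos_of_pos (lt_of_le_of_lt hd0 hsβ)
  have hq := div_le_div₀ (le_trans ps.le (hup _ hss)) (hup _ hss) (hlp β hsβ) hlo'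
  refine (Real.rpow_le_rpow (div_nonneg ps.le pβ.le) hq (by positivity)).trans (le_of_eq ?_)
  have hVe : V 0 = (V 0 ^ (β - (d:ℝ) / 2 - r)) ^ (1 / (β - (d:ℝ) / 2 - r)) := by
    rw [← Real.rpow_mul h0.le, mul_one_div_cancel hE.ne', Real.rpow_one]
  have hLe : (L / α) ^ (((d : ℝ) / 2) / (β - (d : ℝ) / 2 - r)) =
      ((L / α) ^ ((d : ℝ) / 2)) ^ (1 / (β - (d:ℝ) / 2 - r)) := by
    rw [← Real.rpow_mul (by positivity), mul_one_div]
  rw [hLe]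
  conv_rhs => rw [hVe]
  rw [← Real.mul_rpow (by positivity) (by positivity),
    ← Real.mul_rpow (by positivity) (by positivity)]
  congr 1
  have e1 : (d:ℝ) / 2 + r - (d:ℝ) / 2 = r := by ring
  have e2 : V 0 ^ (β - (d:ℝ) / 2 - r) = V 0 ^ (-r) / V 0 ^ (-(β - (d:ℝ) / 2)) := by
    rw [← Real.rpow_sub h0]
    congr 1
    ring
  have e3 : (L / α) ^ ((d : ℝ) / 2) =
      (π / (α / 2)) ^ ((d : ℝ) / 2) / (π / (L / 2)) ^ ((d : ℝ) / 2) := by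
    rw [← Real.div_rpow (by positivity) (by positivity)]
    congr 1
    field_simp
  rw [e1, e2, e3]
  have := (Real.rpow_pos_of_pos h0 (-(β - (d:ℝ) / 2))).ne'
  have : (π / (L / 2)) ^ ((d : ℝ) / 2) ≠ 0 := by positivity
  field_simp
end
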